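/- arXiv:math/0408399 — 2 statements merged into one kernel-verified Lean document; each statement's English description precedes it below -/
import Mathlib

section
/- Let (R,m) be a commutative Noetherian local ring of Krull dimension d such that the localization R_p is a Gorenstein local ring for every prime ideal p with dim(R/p) = d. Then for every semidualizing R-module C and every m-primary ideal J, the Hilbert–Samuel multiplicities satisfy e(J,C) = e(J,R). -/
open CategoryTheory

/-- The `i`-th Ext module of two `R`-modules, over a commutative ring `R`. -/
noncomputable def ExtModule (R : Type) [CommRing R] (M N : ModuleCat.{0} R) (i : ℕ) :
    ModuleCat R :=
  ((Ext R (ModuleCat.{0} R) i).obj (Opposite.op M)).obj N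

/-- `C` is a semidualizing `R`-module: it is finitely generated, the homothety map
`R → Hom_R(C,C)` is bijective, and `Ext^i_R(C,C) = 0` for all `i > 0`. -/
def IsSemidualizing (R : Type) [CommRing R] (C : Type) [AddCommGroup C] [Module R C] : Prop :=
  Module.Finite R C ∧
  Function.Bijective (algebraMap R (Module.End R C)) ∧
  ∀ i : ℕ, 0 < i → Subsingleton (ExtModule R (ModuleCat.of R C) (ModuleCat.of R C) i)

/-- `M` has finite injective dimension over `R`: `Ext^i_R(-, M)` vanishes uniformly
for all large `i`. -/
def HasFiniteInjectiveDimension (R : Type) [CommRing R] (M : Type) [AddCommGroup M]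
    [Module R M] : Prop :=
  ∃ n : ℕ, ∀ (N : ModuleCat.{0} R) (i : ℕ), n < i →
    Subsingleton (ExtModule R N (ModuleCat.of R M) i)

/-- A Gorenstein local ring: a commutative Noetherian local ring having finite injective
dimension as a module over itself. -/
def IsGorensteinLocalRing (R : Type) [CommRing R] : Prop :=
  IsNoetherianRing R ∧ IsLocalRing R ∧ HasFiniteInjectiveDimension R R

/-- The length of an `R`-module, i.e. the Krull dimension of its lattice of submodules. -/
noncomputable def moduleLength (R M : Type) [CommRing R] [AddCommGroup M] [Module R M] :
    WithBot ℕ∞ :=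
  Order.krullDim (Submodule R M)

open CategoryTheory.Abelian in
/-- Vanishing of the derived functor `Ext` in positive degrees implies vanishing of the groups of
morphisms in the derived category. -/
lemma subsingleton_abelianExt_of_extModule {R : Type} [CommRing R] (N M : ModuleCat.{0} R) (i : ℕ)
    (h : Subsingleton (ExtModule R N M (i + 1))) : Subsingleton (Abelian.Ext.{0} N M (i + 1)) := by
  let P := projectiveResolution N
  have hz : Limits.IsZero ((P.complex.linearYonedaObj R M).homology (i + 1)) :=
    Limits.IsZero.of_iso (ModuleCat.isZero_of_subsingleton (ExtModule R N M (i + 1)))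
      (P.isoExt (i + 1) M).symm
  rw [← HomologicalComplex.exactAt_iff_isZero_homology,
    HomologicalComplex.exactAt_iff' _ i (i + 1) (i + 2) (by simp) (by simp),
    ShortComplex.moduleCat_exact_iff] at hz
  refine subsingleton_of_forall_eq 0 fun α => ?_
  obtain ⟨f, hf, rfl⟩ := P.extMk_surjective α (i + 2) rfl
  rw [P.extMk_eq_zero_iff f _ rfl hf i rfl]
  obtain ⟨g, hg⟩ := hz f hf
  exact ⟨g, hg⟩

open CategoryTheory.Abelian in
lemma Abelian.Ext.subsingleton_X₂ {R : Type} [CommRing R] {S : ShortComplex (ModuleCat.{0} R)}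
    (hS : S.ShortExact) (Y : ModuleCat.{0} R) (i : ℕ) (h₁ : Subsingleton (Abelian.Ext.{0} S.X₁ Y i))
    (h₃ : Subsingleton (Abelian.Ext.{0} S.X₃ Y i)) : Subsingleton (Abelian.Ext.{0} S.X₂ Y i) := by
  refine subsingleton_of_forall_eq 0 fun x => ?_
  obtain ⟨y, rfl⟩ := Abelian.Ext.contravariant_sequence_exact₂ hS _ x (Subsingleton.elim _ _)
  rw [Subsingleton.elim y 0, Abelian.Ext.comp_zero]

open CategoryTheory.Abelian in
lemma Abelian.Ext.subsingleton_X₁ {R : Type} [CommRing R] {S : ShortComplex (ModuleCat.{0} R)}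
    (hS : S.ShortExact) (Y : ModuleCat.{0} R) (i : ℕ) (h₂ : Subsingleton (Abelian.Ext.{0} S.X₂ Y i))
    (h₃ : Subsingleton (Abelian.Ext.{0} S.X₃ Y (i + 1))) :
    Subsingleton (Abelian.Ext.{0} S.X₁ Y i) := by
  refine subsingleton_of_forall_eq 0 fun x => ?_
  obtain ⟨y, rfl⟩ := Abelian.Ext.contravariant_sequence_exact₁ hS _ x (add_comm 1 i)
    (Subsingleton.elim _ _)
  rw [Subsingleton.elim y 0, Abelian.Ext.comp_zero]

open CategoryTheory.Abelian in
/-- If `Ext¹(S.X₃, Y)` vanishes, every morphism `S.X₁ ⟶ Y` extends to `S.X₂`. -/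
lemma Abelian.Ext.exists_extension {R : Type} [CommRing R] {S : ShortComplex (ModuleCat.{0} R)}
    (hS : S.ShortExact) (Y : ModuleCat.{0} R) (h₃ : Subsingleton (Abelian.Ext.{0} S.X₃ Y 1))
    (f : S.X₁ ⟶ Y) : ∃ g : S.X₂ ⟶ Y, S.f ≫ g = f := by
  obtain ⟨y, hy⟩ := Abelian.Ext.contravariant_sequence_exact₁ hS _ (Abelian.Ext.mk₀ f)
    (add_comm 1 0)
    (Subsingleton.elim _ _)
  obtain ⟨g, rfl⟩ := Abelian.Ext.addEquiv₀.symm.surjective y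
  refine ⟨g, ?_⟩
  apply Abelian.Ext.addEquiv₀.symm.injective
  simpa using hy

lemma exists_ne_zero_maximalIdeal_smul_eq_zero (A : Type) [CommRing A] [IsLocalRing A]
    [IsArtinianRing A] : ∃ x : A, x ≠ 0 ∧ ∀ a, a * x = 0 ↔ a ∈ IsLocalRing.maximalIdeal A := by
  obtain ⟨p, hp⟩ := associatedPrimes.nonempty A A
  have := hp.isPrime
  have hpm : p = IsLocalRing.maximalIdeal A :=
    IsLocalRing.eq_maximalIdeal inferInstance
  obtain ⟨-, x, hx⟩ := (isAssociatedPrime_iff_exists_injective_linearMap p A).mp hp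
  refine ⟨x (Ideal.Quotient.mk p 1), ?_, fun a => ?_⟩
  · intro h
    have := hx (h.trans (map_zero x).symm)
    exact hp.isPrime.ne_top ((Ideal.eq_top_iff_one p).mpr (Ideal.Quotient.eq_zero_iff_mem.mp this))
  · rw [← smul_eq_mul, ← map_smul, map_eq_zero_iff x hx, ← hpm, ← Ideal.Quotient.eq_zero_iff_mem,
      Algebra.smul_def, map_one, mul_one]
    rfl

open CategoryTheory.Abelian in
/-- Over an Artinian local ring of finite injective dimension, the socle has length one. -/
lemma exists_mul_eq_of_hasFiniteInjectiveDimension (A : Type) [CommRing A] [IsLocalRing A]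
    [IsArtinianRing A] (hA : HasFiniteInjectiveDimension A A) {x y : A} (hx0 : x ≠ 0)
    (hx : ∀ a ∈ IsLocalRing.maximalIdeal A, a * x = 0)
    (hy : ∀ a ∈ IsLocalRing.maximalIdeal A, a * y = 0) : ∃ u, y = u * x := by
  -- the residue field embeds as the span of a socle element
  have key : ∀ (N : Type) [AddCommGroup N] [Module A N]
      (e : N ≃ₗ[A] A ⧸ IsLocalRing.maximalIdeal A) (z : A) (_ : z ≠ 0)
      (_ : ∀ a ∈ IsLocalRing.maximalIdeal A, a * z = 0),
      ∃ f : N →ₗ[A] A, Function.Injective f ∧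
        ∀ a : A, f (e.symm (Ideal.Quotient.mk _ a)) = a * z := by
    intro N _ _ e z hz0 hz
    let g : (A ⧸ IsLocalRing.maximalIdeal A) →ₗ[A] A :=
      Submodule.liftQ _ (LinearMap.toSpanSingleton A A z) (fun a ha => hz a ha)
    have hgmk : ∀ a, g (Ideal.Quotient.mk _ a) = a * z := fun a => rfl
    have hg : Function.Injective g := by
      rw [injective_iff_map_eq_zero]
      intro a
      obtain ⟨a, rfl⟩ := Ideal.Quotient.mk_surjective a
      rw [hgmk, Ideal.Quotient.eq_zero_iff_mem]
      intro h
      by_contra ha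
      rw [IsLocalRing.mem_maximalIdeal, mem_nonunits_iff, not_not] at ha
      exact hz0 (ha.mul_right_eq_zero.mp h)
    exact ⟨g ∘ₗ e, hg.comp e.injective, fun a => by simp [hgmk]⟩
  have vanish : ∀ n : ℕ, (∀ (M : Type) [AddCommGroup M] [Module A M] [Module.Finite A M] (i : ℕ),
      n < i → Subsingleton (Abelian.Ext.{0} (ModuleCat.of A M) (ModuleCat.of A A) i)) →
      ∀ (M : Type) [AddCommGroup M] [Module A M] [Module.Finite A M] (i : ℕ),
      0 < i → Subsingleton (Abelian.Ext.{0} (ModuleCat.of A M) (ModuleCat.of A A) i) := by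
    intro n
    induction n with
    | zero => exact fun h => h
    | succ n ih =>
      refine fun h => ih fun M _ _ _ i hi => ?_
      rcases (Nat.succ_le_of_lt hi).lt_or_eq with hi | rfl
      · exact h M i hi
      induction ‹Module.Finite A M› using
        IsNoetherianRing.induction_on_isQuotientEquivQuotientPrime A with
      | subsingleton N =>
        refine subsingleton_of_forall_eq 0 fun x => ?_
        exact Abelian.Ext.eq_zero_of_projective x
      | quotient N p e =>
        obtain ⟨p, hp⟩ := p
        obtain rfl : p = IsLocalRing.maximalIdeal A := IsLocalRing.eq_maximalIdeal inferInstance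
        obtain ⟨f, hf, -⟩ := key N e x hx0 hx
        let S : ShortComplex (ModuleCat.{0} A) :=
          ModuleCat.shortComplexOfCompEqZero _ _ f.exact_map_mkQ_range.linearMap_comp_eq_zero
        have hS : S.ShortExact := ModuleCat.shortComplex_shortExact S
          f.exact_map_mkQ_range hf (Submodule.mkQ_surjective _)
        refine Abelian.Ext.subsingleton_X₁ hS _ _ ?_ (h _ _ (by lia))
        exact subsingleton_of_forall_eq 0 fun x => Abelian.Ext.eq_zero_of_projective x
      | exact N₁ N₂ N₃ f g hf hg hfg h₁ h₃ =>
        let S : ShortComplex (ModuleCat.{0} A) :=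
          ModuleCat.shortComplexOfCompEqZero _ _ hfg.linearMap_comp_eq_zero
        have hS : S.ShortExact := ModuleCat.shortComplex_shortExact S hfg hf hg
        exact Abelian.Ext.subsingleton_X₂ hS _ _ h₁ h₃
  obtain ⟨n, hn⟩ := hA
  obtain ⟨f, hf, hfx⟩ := key _ (LinearEquiv.refl A _) x hx0 hx
  let g : (A ⧸ IsLocalRing.maximalIdeal A) →ₗ[A] A :=
    Submodule.liftQ _ (LinearMap.toSpanSingleton A A y) (fun a ha => hy a ha)
  let S : ShortComplex (ModuleCat.{0} A) :=
    ModuleCat.shortComplexOfCompEqZero _ _ f.exact_map_mkQ_range.linearMap_comp_eq_zero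
  have hS : S.ShortExact := ModuleCat.shortComplex_shortExact S
    f.exact_map_mkQ_range hf (Submodule.mkQ_surjective _)
  obtain ⟨φ, hφ⟩ := Abelian.Ext.exists_extension hS (ModuleCat.of A A)
    (vanish n (fun M _ _ _ i hi => by
      obtain ⟨j, rfl⟩ : ∃ j, i = j + 1 := ⟨i - 1, by lia⟩
      exact subsingleton_abelianExt_of_extModule _ _ _ (hn _ _ hi)) _ 1 one_pos) (ModuleCat.ofHom g)
  have h1 : φ.hom (f (Ideal.Quotient.mk _ 1)) = g (Ideal.Quotient.mk _ 1) :=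
    congr($(hφ).hom (Ideal.Quotient.mk _ 1))
  have h2 : f (Ideal.Quotient.mk _ 1) = 1 * x := hfx 1
  have h3 : g (Ideal.Quotient.mk _ 1) = 1 * y := rfl
  rw [h2, h3, one_mul, one_mul] at h1
  refine ⟨φ.hom (1 : A), ?_⟩
  rw [← h1, mul_comm, ← smul_eq_mul, ← map_smul, smul_eq_mul, mul_one]

lemma exists_linearMap_residue_ne_zero {A D : Type} [CommRing A] [IsLocalRing A] [AddCommGroup D]
    [Module A D] {d : D} (hd : d ∉ IsLocalRing.maximalIdeal A • (⊤ : Submodule A D)) :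
    ∃ g : D →ₗ[A] A ⧸ IsLocalRing.maximalIdeal A, g d ≠ 0 := by
  let := Ideal.Quotient.field (IsLocalRing.maximalIdeal A)
  have h0 : (Submodule.Quotient.mk d : D ⧸ IsLocalRing.maximalIdeal A • (⊤ : Submodule A D)) ≠ 0 :=
    fun h => hd ((Submodule.Quotient.mk_eq_zero _).mp h)
  obtain ⟨g, hg⟩ : ∃ g : Module.Dual (A ⧸ IsLocalRing.maximalIdeal A)
      (D ⧸ IsLocalRing.maximalIdeal A • (⊤ : Submodule A D)), g (Submodule.Quotient.mk d) ≠ 0 := by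
    by_contra! h
    exact h0 ((Module.forall_dual_apply_eq_zero_iff _ _).mp h)
  exact ⟨(g.restrictScalars A) ∘ₗ Submodule.mkQ _, hg⟩

/-- If the socle of an Artinian local ring `A` is generated by each of its nonzero elements, then
`A` is the only finite `A`-module whose homothety map is bijective. -/
lemma nonempty_linearEquiv_of_bijective_algebraMap_end {A D : Type} [CommRing A] [IsLocalRing A]
    [IsArtinianRing A] [AddCommGroup D] [Module A D] [Module.Finite A D]
    (hA : ∀ x y : A, x ≠ 0 → (∀ a ∈ IsLocalRing.maximalIdeal A, a * x = 0) →
      (∀ a ∈ IsLocalRing.maximalIdeal A, a * y = 0) → ∃ u, y = u * x)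
    (hD : Function.Bijective (algebraMap A (Module.End A D))) : Nonempty (A ≃ₗ[A] D) := by
  have hD0 : ∀ a : A, (∀ d : D, a • d = 0) → a = 0 := fun a ha =>
    hD.1 (by ext d; simpa using ha d)
  obtain ⟨x, hx0, hx⟩ := exists_ne_zero_maximalIdeal_smul_eq_zero A
  obtain ⟨d', hd'⟩ : ∃ d : D, x • d ≠ 0 := by
    by_contra! h
    exact hx0 (hD0 x h)
  let σ : (A ⧸ IsLocalRing.maximalIdeal A) →ₗ[A] D :=
    Submodule.liftQ _ (LinearMap.toSpanSingleton A D (x • d')) (fun a ha => by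
      simp [smul_smul, (hx a).mpr ha])
  have hσmk : ∀ a, σ (Ideal.Quotient.mk _ a) = a • x • d' := fun a => rfl
  have hσ : Function.Injective σ := by
    rw [injective_iff_map_eq_zero]
    intro a
    obtain ⟨a, rfl⟩ := Ideal.Quotient.mk_surjective a
    rw [hσmk, Ideal.Quotient.eq_zero_iff_mem]
    intro h
    by_contra ha
    rw [IsLocalRing.mem_maximalIdeal, mem_nonunits_iff, not_not] at ha
    exact hd' (ha.smul_eq_zero.mp h)
  have hsoc : ∀ g : D →ₗ[A] A ⧸ IsLocalRing.maximalIdeal A, ∃ b : A,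
      (∀ a ∈ IsLocalRing.maximalIdeal A, a * b = 0) ∧ ∀ d, σ (g d) = b • d := by
    intro g
    obtain ⟨b, hb⟩ := hD.2 (σ ∘ₗ g)
    have hb' : ∀ d, σ (g d) = b • d := fun d => (congr($hb d)).symm
    refine ⟨b, fun a ha => hD0 _ fun d => ?_, hb'⟩
    rw [mul_smul, ← hb', ← map_smul]
    obtain ⟨c, hc⟩ := Ideal.Quotient.mk_surjective (g d)
    rw [← hc, Algebra.smul_def]
    have : algebraMap A (A ⧸ IsLocalRing.maximalIdeal A) a = 0 :=
      Ideal.Quotient.eq_zero_iff_mem.mpr ha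
    rw [this, zero_mul, map_zero]
  have hmD : IsLocalRing.maximalIdeal A • (⊤ : Submodule A D) ≠ ⊤ := by
    intro h
    have := Submodule.eq_bot_of_le_smul_of_le_jacobson_bot _ (⊤ : Submodule A D)
      Module.Finite.fg_top h.ge (IsLocalRing.maximalIdeal_le_jacobson _)
    exact hd' ((Submodule.mem_bot A).mp (this.le Submodule.mem_top))
  obtain ⟨d₁, -, hd₁⟩ := SetLike.exists_of_lt (lt_top_iff_ne_top.mpr hmD)
  obtain ⟨f, hf⟩ := exists_linearMap_residue_ne_zero hd₁
  have hker : ∀ d, f d = 0 → d ∈ IsLocalRing.maximalIdeal A • (⊤ : Submodule A D) := by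
    intro d hd
    by_contra hdm
    obtain ⟨g, hg⟩ := exists_linearMap_residue_ne_zero hdm
    obtain ⟨a, ha, hfa⟩ := hsoc f
    obtain ⟨b, hb, hgb⟩ := hsoc g
    have ha0 : a ≠ 0 := by
      rintro rfl
      exact hf (hσ (by rw [hfa, zero_smul, map_zero]))
    obtain ⟨u, rfl⟩ := hA a b ha0 ha hb
    exact hg (hσ (by rw [hgb, mul_smul, ← hfa, hd, map_zero, smul_zero]))
  obtain ⟨c, hc⟩ := Ideal.Quotient.mk_surjective (f d₁)
  have hcu : IsUnit c := by
    by_contra h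
    exact hf (hc ▸ Ideal.Quotient.eq_zero_iff_mem.mpr h)
  have hspan : (⊤ : Submodule A D) ≤ Submodule.span A {d₁} := by
    refine Submodule.le_of_le_smul_of_le_jacobson_bot Module.Finite.fg_top
      (IsLocalRing.maximalIdeal_le_jacobson ⊥) fun d _ => ?_
    obtain ⟨e, he⟩ := Ideal.Quotient.mk_surjective (f d)
    obtain ⟨v, hv⟩ := hcu.exists_right_inv
    have : d - (e * v) • d₁ ∈ IsLocalRing.maximalIdeal A • (⊤ : Submodule A D) := by
      apply hker
      rw [map_sub, map_smul, ← hc, ← he, Algebra.smul_def]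
      change Ideal.Quotient.mk _ e - Ideal.Quotient.mk _ (e * v) * Ideal.Quotient.mk _ c = 0
      rw [← map_mul, mul_assoc, mul_comm v, hv, mul_one, sub_self]
    rw [← sub_add_cancel d ((e * v) • d₁), add_comm]
    exact Submodule.add_mem_sup (Submodule.smul_mem _ _ (Submodule.mem_span_singleton_self _)) this
  refine ⟨LinearEquiv.ofBijective (LinearMap.toSpanSingleton A D d₁) ⟨?_, fun d => ?_⟩⟩
  · rw [injective_iff_map_eq_zero]
    intro a ha
    refine hD0 a fun d => ?_
    obtain ⟨r, rfl⟩ := Submodule.mem_span_singleton.mp (hspan (Submodule.mem_top (x := d)))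
    rw [smul_comm]
    simp_all
  · exact Submodule.mem_span_singleton.mp (hspan (Submodule.mem_top (x := d)))

lemma bijective_algebraMap_end_localizedModule {R C : Type} [CommRing R] [IsNoetherianRing R]
    [AddCommGroup C] [Module R C] [Module.Finite R C]
    (h : Function.Bijective (algebraMap R (Module.End R C))) (p : Ideal R) [p.IsPrime] :
    Function.Bijective (algebraMap (Localization.AtPrime p)
      (Module.End (Localization.AtPrime p) (LocalizedModule p.primeCompl C))) := by
  have := Module.finitePresentation_of_finite R C
  let e : R ≃ₗ[R] Module.End R C := LinearEquiv.ofBijective (Algebra.linearMap R _) h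
  let ψ := IsLocalizedModule.mapExtendScalars p.primeCompl
    (LocalizedModule.mkLinearMap p.primeCompl C)
    (LocalizedModule.mkLinearMap p.primeCompl C) (Localization.AtPrime p)
  have : IsLocalizedModule p.primeCompl (ψ ∘ₗ e.toLinearMap) :=
    IsLocalizedModule.of_linearEquiv_right _ _ _
  let E := IsLocalizedModule.linearEquiv p.primeCompl
    (Algebra.linearMap R (Localization.AtPrime p)) (ψ ∘ₗ e.toLinearMap)
  have hE : (Algebra.linearMap (Localization.AtPrime p) (Module.End (Localization.AtPrime p)
      (LocalizedModule p.primeCompl C))).restrictScalars R = E.toLinearMap := by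
    apply IsLocalizedModule.ext p.primeCompl (Algebra.linearMap R (Localization.AtPrime p))
      (IsLocalizedModule.map_units (ψ ∘ₗ e.toLinearMap))
    ext d
    obtain ⟨⟨m, s⟩, rfl⟩ := IsLocalizedModule.mk'_surjective p.primeCompl
      (LocalizedModule.mkLinearMap p.primeCompl C) d
    have h1 := IsLocalizedModule.linearEquiv_apply p.primeCompl
      (Algebra.linearMap R (Localization.AtPrime p)) (ψ ∘ₗ e.toLinearMap) 1
    rw [Algebra.linearMap_apply, map_one] at h1
    have h2 : e 1 = 1 := map_one (algebraMap R _)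
    simp [E, h1, h2, ψ, IsLocalizedModule.map_mk']
  have hE' : ⇑(algebraMap (Localization.AtPrime p) (Module.End (Localization.AtPrime p)
      (LocalizedModule p.primeCompl C))) = E := funext fun a => congr($hE a)
  rw [hE']
  exact E.bijective

lemma exists_linearMap_of_surjective_localizedModule {R M N : Type} [CommRing R] [AddCommGroup M]
    [Module R M] [AddCommGroup N] [Module R N] [Module.FinitePresentation R M] (S : Submonoid R)
    (φ : LocalizedModule S M →ₗ[R] LocalizedModule S N) (hφ : Function.Surjective φ) :
    ∃ f : M →ₗ[R] N, ∀ y, ∃ s ∈ S, s • y ∈ LinearMap.range f := by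
  obtain ⟨f, s, hf⟩ := Module.FinitePresentation.exists_lift_of_isLocalizedModule S
    (LocalizedModule.mkLinearMap S N) (φ ∘ₗ LocalizedModule.mkLinearMap S M)
  refine ⟨f, fun y => ?_⟩
  obtain ⟨z, hz⟩ := hφ (LocalizedModule.mkLinearMap S N y)
  obtain ⟨⟨m, t⟩, hm⟩ := IsLocalizedModule.surj S (LocalizedModule.mkLinearMap S M) z
  have h : LocalizedModule.mkLinearMap S N ((s * t : S) • y) =
      LocalizedModule.mkLinearMap S N (f m) := by
    have h1 : LocalizedModule.mkLinearMap S N (f m) = s • φ (LocalizedModule.mkLinearMap S M m) :=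
      congr($hf m)
    rw [h1, ← hm, Submonoid.smul_def, Submonoid.smul_def, map_smul, Submonoid.smul_def, map_smul,
      hz,
      smul_smul]
    rfl
  obtain ⟨u, hu⟩ := IsLocalizedModule.exists_of_eq (S := S) h
  refine ⟨u * (s * t), S.mul_mem u.2 (S.mul_mem s.2 t.2), u • m, ?_⟩
  rw [mul_smul]
  simpa [Submonoid.smul_def] using hu.symm

section RelativeLength

variable {R M : Type*} [CommRing R] [AddCommGroup M] [Module R M]

/-- The length of the subquotient `A / (A ⊓ B)` of a module. -/
noncomputable def Submodule.relLength (A B : Submodule R M) : ℕ∞ :=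
  Module.length R (A ⧸ B.submoduleOf A)

theorem Submodule.relLength_eq_of_surjective {P : Type*} [AddCommGroup P] [Module R P]
    {A B : Submodule R M} (φ : A →ₗ[R] P) (hφ : Function.Surjective φ)
    (hker : ∀ a, φ a = 0 ↔ (a : M) ∈ B) : A.relLength B = Module.length R P := by
  have h : B.submoduleOf A = LinearMap.ker φ := by
    ext a
    rw [LinearMap.mem_ker, hker]
    rfl
  exact ((Submodule.quotEquivOfEq _ _ h).trans
    (φ.quotKerEquivOfSurjective hφ)).length_eq

theorem Submodule.relLength_self (A : Submodule R M) : A.relLength A = 0 := by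
  rw [Submodule.relLength_eq_of_surjective (P := (⊥ : Submodule R M)) (0 : A →ₗ[R] _)
    (fun y => ⟨0, Subsingleton.elim _ _⟩) (fun a => ⟨fun _ => a.2, fun _ => rfl⟩)]
  exact Module.length_eq_zero

theorem Submodule.relLength_add {B K A : Submodule R M} (h₁ : B ≤ K) (h₂ : K ≤ A) :
    A.relLength B = K.relLength B + A.relLength K := by
  let f : (K ⧸ B.submoduleOf K) →ₗ[R] (A ⧸ B.submoduleOf A) :=
    Submodule.mapQ _ _ (Submodule.inclusion h₂) (fun x hx => hx)
  let g : (A ⧸ B.submoduleOf A) →ₗ[R] (A ⧸ K.submoduleOf A) :=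
    Submodule.mapQ _ _ LinearMap.id (fun x hx => h₁ hx)
  refine Module.length_eq_add_of_exact f g ?_ ?_ ?_
  · rw [← LinearMap.ker_eq_bot, LinearMap.ker_eq_bot']
    intro y
    obtain ⟨y, rfl⟩ := Submodule.Quotient.mk_surjective _ y
    intro hy
    replace hy := (Submodule.Quotient.mk_eq_zero _).1 hy
    exact (Submodule.Quotient.mk_eq_zero _).2 hy
  · intro y
    obtain ⟨y, rfl⟩ := Submodule.Quotient.mk_surjective _ y
    exact ⟨Submodule.Quotient.mk y, rfl⟩
  · intro y
    obtain ⟨y, rfl⟩ := Submodule.Quotient.mk_surjective _ y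
    constructor
    · intro hy
      replace hy := (Submodule.Quotient.mk_eq_zero _).1 hy
      exact ⟨Submodule.Quotient.mk ⟨y, hy⟩, rfl⟩
    · rintro ⟨z, hz⟩
      obtain ⟨z, rfl⟩ := Submodule.Quotient.mk_surjective _ z
      rw [← hz]
      refine (Submodule.Quotient.mk_eq_zero _).2 ?_
      exact z.2

theorem Submodule.relLength_inf_comap_lsmul (x : R) (A B : Submodule R M) :
    A.relLength (A ⊓ B.comap (LinearMap.lsmul R M x)) =
      (A.map (LinearMap.lsmul R M x) ⊔ B).relLength B := by
  refine Submodule.relLength_eq_of_surjective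
    ((Submodule.mkQ _).comp (LinearMap.codRestrict (A.map (LinearMap.lsmul R M x) ⊔ B)
      ((LinearMap.lsmul R M x).comp A.subtype)
      (fun a => Submodule.mem_sup_left ⟨a, a.2, rfl⟩))) ?_ ?_
  · intro y
    obtain ⟨⟨y, hy⟩, rfl⟩ := Submodule.Quotient.mk_surjective _ y
    obtain ⟨_, ⟨a, ha, rfl⟩, b, hb, rfl⟩ := Submodule.mem_sup.1 hy
    refine ⟨⟨a, ha⟩, (Submodule.Quotient.eq _).2 ?_⟩
    change x • a - (x • a + b) ∈ B
    simpa using hb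
  · intro a
    refine (Submodule.Quotient.mk_eq_zero _).trans ?_
    change x • (a : M) ∈ B ↔ (a : M) ∈ A ⊓ _
    simp

theorem Submodule.length_quotient_eq_relLength (A : Submodule R M) :
    Module.length R (M ⧸ A) = (⊤ : Submodule R M).relLength A :=
  (Submodule.relLength_eq_of_surjective (A.mkQ.comp (⊤ : Submodule R M).subtype)
    ((Submodule.mkQ_surjective _).comp fun y => ⟨⟨y, trivial⟩, rfl⟩)
    (fun _ => Submodule.Quotient.mk_eq_zero _)).symm

end RelativeLength

theorem Polynomial.exists_eval_add_one_eq_eval_add (Q : Polynomial ℚ) :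
    ∃ P : Polynomial ℚ, ∀ x : ℚ, P.eval (x + 1) = P.eval x + Q.eval x := by
  induction Q using Polynomial.induction_on' with
  | add p q hp hq =>
    obtain ⟨P, hP⟩ := hp
    obtain ⟨P', hP'⟩ := hq
    refine ⟨P + P', fun x => ?_⟩
    simp only [Polynomial.eval_add, hP, hP']
    ring
  | monomial n a =>
    refine ⟨Polynomial.C (a / (n + 1)) * Polynomial.bernoulli (n + 1), fun x => ?_⟩
    rw [add_comm x 1]
    simp only [Polynomial.eval_mul, Polynomial.eval_C, Polynomial.bernoulli_eval_one_add,
      Polynomial.eval_monomial]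
    have : (n + 1 : ℚ) ≠ 0 := by positivity
    push_cast
    field_simp

theorem Polynomial.exists_eventually_eq_eval_of_sub {h : ℕ → ℚ} {Q : Polynomial ℚ}
    (hQ : ∀ᶠ n : ℕ in Filter.atTop, h (n + 1) - h n = Q.eval (n : ℚ)) :
    ∃ P : Polynomial ℚ, ∀ᶠ n : ℕ in Filter.atTop, h n = P.eval (n : ℚ) := by
  obtain ⟨P, hP⟩ := Q.exists_eval_add_one_eq_eval_add
  obtain ⟨N, hN⟩ := Filter.eventually_atTop.1 hQ
  refine ⟨P + Polynomial.C (h N - P.eval (N : ℚ)), Filter.eventually_atTop.2 ⟨N, fun n hn => ?_⟩⟩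
  induction n, hn using Nat.le_induction with
  | base => simp
  | succ n hn ih =>
    have h₁ := hN n hn
    have h₂ := hP n
    simp only [Polynomial.eval_add, Polynomial.eval_C] at ih ⊢
    push_cast
    rw [h₂]
    linarith

section PairsOfFiltrations

variable {R M : Type*} [CommRing R] [AddCommGroup M] [Module R M]

/-- A sequence of submodules that is mapped into its shift by the elements of `S`, and lies
between two given sequences. -/
structure IsIntermediateSequence (S : Finset R) (A B N : ℕ → Submodule R M) : Prop where
  le_left : ∀ n, N n ≤ A n
  right_le : ∀ n, B n ≤ N n
  smul_mem : ∀ x ∈ S, ∀ n, ∀ a ∈ N n, x • a ∈ N (n + 1)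

theorem exists_polynomial_relLength (S : Finset R) : ∀ (A B : ℕ → Submodule R M)
    (_ : IsIntermediateSequence S A B A) (_ : IsIntermediateSequence S A B B)
    (_ : ∀ n, (A n).relLength (B n) ≠ ⊤)
    (_ : ∀ N : ℕ → ℕ → Submodule R M, Monotone N → (∀ k, IsIntermediateSequence S A B (N k)) →
      ∃ k₀, ∀ k, k₀ ≤ k → N k₀ = N k),
    ∃ P : Polynomial ℚ, ∀ᶠ n : ℕ in Filter.atTop,
      (((A n).relLength (B n)).toNat : ℚ) = P.eval (n : ℚ) := by
  classical
  induction S using Finset.induction_on with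
  | empty =>
    intro A B hA _ _ hacc
    have hBA := hA.right_le
    obtain ⟨k₀, hk₀⟩ := hacc (fun k n => if n < k then A n else B n)
      (fun k l hkl n => by
        dsimp only
        split_ifs with h₁ h₂
        · rfl
        · omega
        · exact hBA n
        · rfl)
      (fun k => ⟨fun n => by split_ifs; exacts [le_rfl, hBA n],
        fun n => by split_ifs; exacts [hBA n, le_rfl],
        fun x hx => absurd hx (Finset.notMem_empty x)⟩)
    refine ⟨0, Filter.eventually_atTop.2 ⟨k₀, fun n hn => ?_⟩⟩
    have h₁ := congrFun ((hk₀ n hn).symm.trans (hk₀ (n + 1) (by omega))) n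
    simp only [lt_irrefl, if_false, Nat.lt_succ_self, if_true] at h₁
    rw [h₁, Submodule.relLength_self]
    simp
  | insert x S _ ih =>
    intro A B hA hB hfin hacc
    have hBA := hA.right_le
    have hxS : x ∈ insert x S := Finset.mem_insert_self _ _
    have hSx : ∀ y ∈ S, y ∈ insert x S := fun y hy => Finset.mem_insert_of_mem hy
    let K : ℕ → Submodule R M := fun n => A n ⊓ (B (n + 1)).comap (LinearMap.lsmul R M x)
    let D : ℕ → Submodule R M := fun n => (A n).map (LinearMap.lsmul R M x) ⊔ B (n + 1)
    have hBK : ∀ n, B n ≤ K n := fun n a ha => ⟨hBA n ha, hB.smul_mem x hxS n a ha⟩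
    have hKA : ∀ n, K n ≤ A n := fun n => inf_le_left
    have hBD : ∀ n, B (n + 1) ≤ D n := fun n => le_sup_right
    have hDA : ∀ n, D n ≤ A (n + 1) := fun n => sup_le
      (by rintro _ ⟨a, ha, rfl⟩; exact hA.smul_mem x hxS n a ha) (hBA _)
    have hxA : ∀ n, ∀ a ∈ A n, x • a ∈ D n := fun n a ha => Submodule.mem_sup_left ⟨a, ha, rfl⟩
    have hKs : ∀ y ∈ S, ∀ n, ∀ a ∈ K n, y • a ∈ K (n + 1) := by
      rintro y hy n a ⟨ha, ha'⟩
      refine ⟨hA.smul_mem y (hSx y hy) n a ha, ?_⟩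
      have := hB.smul_mem y (hSx y hy) (n + 1) _ ha'
      rw [LinearMap.lsmul_apply, smul_comm] at this
      exact this
    have hDs : ∀ y ∈ S, ∀ n, ∀ a ∈ D n, y • a ∈ D (n + 1) := by
      intro y hy n a ha
      obtain ⟨_, ⟨c, hc, rfl⟩, b, hb, rfl⟩ := Submodule.mem_sup.1 ha
      rw [smul_add]
      refine Submodule.add_mem_sup ⟨y • c, hA.smul_mem y (hSx y hy) n c hc, ?_⟩
        (hB.smul_mem y (hSx y hy) _ b hb)
      exact smul_comm x y c
    have hlen₁ : ∀ n, (A n).relLength (B n) =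
        (K n).relLength (B n) + (D n).relLength (B (n + 1)) := fun n => by
      rw [Submodule.relLength_add (hBK n) (hKA n), Submodule.relLength_inf_comap_lsmul]
    have hlen₂ : ∀ n, (A (n + 1)).relLength (B (n + 1)) =
        (D n).relLength (B (n + 1)) + (A (n + 1)).relLength (D n) := fun n =>
      Submodule.relLength_add (hBD n) (hDA n)
    have hfK : ∀ n, (K n).relLength (B n) ≠ ⊤ := fun n h => hfin n (by rw [hlen₁, h, top_add])
    have hfD : ∀ n, (D n).relLength (B (n + 1)) ≠ ⊤ := fun n h =>
      hfin n (by rw [hlen₁, h, add_top])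
    have hfA : ∀ n, (A (n + 1)).relLength (D n) ≠ ⊤ := fun n h =>
      hfin (n + 1) (by rw [hlen₂, h, add_top])
    obtain ⟨P₁, hP₁⟩ := ih K B ⟨fun _ => le_rfl, hBK, hKs⟩
      ⟨hBK, fun _ => le_rfl, fun y hy => hB.smul_mem y (hSx y hy)⟩ hfK (by
        intro N hN hN'
        refine hacc N hN (fun k => ⟨fun n => ((hN' k).le_left n).trans (hKA n),
          (hN' k).right_le, ?_⟩)
        intro y hy n a ha
        obtain rfl | hy := Finset.mem_insert.1 hy
        · exact (hN' k).right_le _ ((hN' k).le_left n ha).2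
        · exact (hN' k).smul_mem y hy n a ha)
    obtain ⟨P₂, hP₂⟩ := ih (fun n => A (n + 1)) D
      ⟨fun _ => le_rfl, hDA, fun y hy n => hA.smul_mem y (hSx y hy) (n + 1)⟩
      ⟨hDA, fun _ => le_rfl, hDs⟩ hfA (by
        intro N hN hN'
        obtain ⟨k₀, hk₀⟩ := hacc (fun k n => Nat.casesOn n (B 0) (N k))
          (fun k l hkl n => by
            cases n with
            | zero => exact le_rfl
            | succ n => exact hN hkl n)
          (fun k => ⟨fun n => by
              cases n with
              | zero => exact hBA 0
              | succ n => exact (hN' k).le_left n,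
            fun n => by
              cases n with
              | zero => exact le_rfl
              | succ n => exact (hBD n).trans ((hN' k).right_le n),
            fun y hy n a ha => by
              cases n with
              | zero => exact (hN' k).right_le 0 (hBD 0 (hB.smul_mem y hy 0 a ha))
              | succ n =>
                obtain rfl | hy := Finset.mem_insert.1 hy
                · exact (hN' k).right_le _ (hxA _ _ ((hN' k).le_left n ha))
                · exact (hN' k).smul_mem y hy n a ha⟩)
        exact ⟨k₀, fun k hk => funext fun n => congrFun (hk₀ k hk) (n + 1)⟩)
    refine Polynomial.exists_eventually_eq_eval_of_sub (Q := P₂ - P₁) ?_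
    filter_upwards [hP₁, hP₂] with n h₁ h₂
    rw [Polynomial.eval_sub, ← h₁, ← h₂, hlen₁ n, hlen₂ n, ENat.toNat_add (hfK n) (hfD n),
      ENat.toNat_add (hfD n) (hfA n)]
    push_cast
    ring

end PairsOfFiltrations

section HilbertSamuel

variable {R M : Type*} [CommRing R] [IsNoetherianRing R] [AddCommGroup M] [Module R M]
  [Module.Finite R M]

theorem Ideal.Filtration.exists_forall_eq_of_monotone {J : Ideal R} (F : ℕ → J.Filtration M)
    (hF : Monotone fun k => (F k).N) (hle : ∀ k n, (F k).N n ≤ J ^ n • (⊤ : Submodule R M)) :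
    ∃ k₀, ∀ k, k₀ ≤ k → (F k₀).N = (F k).N := by
  let T := (J.stableFiltration (⊤ : Submodule R M)).submodule
  have hT : T.FG := (Ideal.Filtration.submodule_fg_iff_stable _
    (fun i => IsNoetherian.noetherian _)).2 (J.stableFiltration_stable _)
  have hnoeth : IsNoetherian (reesAlgebra J) T := isNoetherian_of_fg_of_noetherian T hT
  have hFT : ∀ k, (F k).submodule ≤ T := fun k f hf =>
    (Ideal.Filtration.mem_submodule _ _).2 fun i =>
      hle k i ((Ideal.Filtration.mem_submodule _ _).1 hf i)
  obtain ⟨k₀, hk₀⟩ := monotone_stabilizes_iff_noetherian.2 hnoeth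
    ⟨fun k => (F k).submodule.comap T.subtype, fun k l hkl f hf =>
      (Ideal.Filtration.mem_submodule _ _).2 fun i =>
        hF hkl i ((Ideal.Filtration.mem_submodule _ _).1 hf i)⟩
  have key : ∀ k l : ℕ, (F k).submodule.comap T.subtype = (F l).submodule.comap T.subtype →
      (F k).N ≤ (F l).N := by
    intro k l hkl n a ha
    have h₁ : PolynomialModule.single R n a ∈ (F k).submodule := by
      refine (Ideal.Filtration.mem_submodule _ _).2 fun i => ?_
      rw [PolynomialModule.coeff_single, Finsupp.single_apply]
      split_ifs with h
      · exact h ▸ ha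
      · exact zero_mem _
    have h₂ : (⟨_, hFT k h₁⟩ : T) ∈ (F k).submodule.comap T.subtype := h₁
    rw [hkl] at h₂
    have h₃ := (Ideal.Filtration.mem_submodule _ _).1 h₂ n
    rw [Submodule.subtype_apply, PolynomialModule.coeff_single, Finsupp.single_eq_same] at h₃
    exact h₃
  exact ⟨k₀, fun k hk => le_antisymm (key _ _ (hk₀ k hk)) (key _ _ (hk₀ k hk).symm)⟩

/-- The Hilbert–Samuel function of a finitely generated module with respect to an ideal of
definition is eventually a polynomial. -/
theorem exists_polynomial_length_quotient_pow_smul (J : Ideal R)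
    (hfin : ∀ n, Module.length R (M ⧸ (J ^ n • (⊤ : Submodule R M))) ≠ ⊤) :
    ∃ P : Polynomial ℚ, ∀ᶠ n : ℕ in Filter.atTop,
      ((Module.length R (M ⧸ (J ^ n • (⊤ : Submodule R M)))).toNat : ℚ) = P.eval (n : ℚ) := by
  let A : ℕ → Submodule R M := fun n => J ^ n • (⊤ : Submodule R M)
  have hanti : ∀ n, A (n + 1) ≤ A n := fun n =>
    Submodule.smul_mono_left (Ideal.pow_le_pow_right n.le_succ)
  have htop : ∀ n, Module.length R (M ⧸ A n) = (⊤ : Submodule R M).relLength (A n) :=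
    fun n => (A n).length_quotient_eq_relLength
  have hadd : ∀ n, Module.length R (M ⧸ A (n + 1)) =
      (A n).relLength (A (n + 1)) + Module.length R (M ⧸ A n) := fun n => by
    rw [htop, htop, Submodule.relLength_add (hanti n) le_top]
  have hrel : ∀ n, (A n).relLength (A (n + 1)) ≠ ⊤ := fun n h =>
    hfin (n + 1) ((hadd n).trans (by rw [h, top_add]))
  obtain ⟨S, hS⟩ := (inferInstance : IsNoetherianRing R).noetherian J
  have hSJ : ∀ x ∈ S, x ∈ J := fun x hx => hS ▸ Submodule.subset_span hx
  have hA : ∀ x ∈ S, ∀ n, ∀ a ∈ A n, x • a ∈ A (n + 1) := fun x hx n a ha => by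
    have := Submodule.smul_mem_smul (hSJ x hx) ha
    rwa [← Submodule.mul_smul, ← pow_succ'] at this
  obtain ⟨P, hP⟩ := exists_polynomial_relLength S A (fun n => A (n + 1))
    ⟨fun _ => le_rfl, hanti, hA⟩ ⟨hanti, fun _ => le_rfl, fun x hx n => hA x hx (n + 1)⟩ hrel (by
      intro N hN hN'
      let F : ℕ → J.Filtration M := fun k =>
        { N := N k
          mono := fun n => ((hN' k).le_left (n + 1)).trans ((hN' k).right_le n)
          smul_le := fun n => by
            refine Submodule.smul_le.2 fun r hr a ha => ?_
            rw [← hS] at hr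
            induction hr using Submodule.span_induction with
            | mem x hx => exact (hN' k).smul_mem x hx n a ha
            | zero => rw [zero_smul]; exact zero_mem _
            | add x y _ _ hx hy => rw [add_smul]; exact add_mem hx hy
            | smul r x _ hx => rw [smul_assoc]; exact Submodule.smul_mem _ r hx }
      exact Ideal.Filtration.exists_forall_eq_of_monotone F hN (fun k => (hN' k).le_left))
  refine Polynomial.exists_eventually_eq_eval_of_sub (Q := P) ?_
  filter_upwards [hP] with n hn
  rw [← hn]
  change ((Module.length R (M ⧸ A (n + 1))).toNat : ℚ) - ((Module.length R (M ⧸ A n)).toNat : ℚ) = _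
  rw [hadd, ENat.toNat_add (hrel n) (hfin n)]
  push_cast
  ring

end HilbertSamuel

section FiniteLength

variable {R M : Type*} [CommRing R] [AddCommGroup M] [Module R M]

theorem Module.length_ne_top_of_le_annihilator [IsNoetherianRing R] [Module.Finite R M]
    (Q : Ideal R) (hQ : ∀ p : Ideal R, p.IsPrime → Q ≤ p → p.IsMaximal)
    (hM : ∀ r ∈ Q, ∀ m : M, r • m = 0) : Module.length R M ≠ ⊤ := by
  have hart : IsArtinianRing (R ⧸ Q) := by
    rw [isArtinianRing_iff_krullDimLE_zero, Ring.krullDimLE_zero_iff]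
    intro P hP
    have h := hQ (P.comap (Ideal.Quotient.mk Q)) inferInstance (fun x hx => by
      rw [Ideal.mem_comap, Ideal.Quotient.eq_zero_iff_mem.2 hx]
      exact zero_mem _)
    have h' := h.map_of_surjective_of_ker_le (f := Ideal.Quotient.mk Q)
      Ideal.Quotient.mk_surjective (Ideal.comap_mono bot_le)
    rwa [Ideal.map_comap_of_surjective _ Ideal.Quotient.mk_surjective] at h'
  have htors : Module.IsTorsionBySet R M (Q : Set R) := fun m r => hM r r.2 m
  let : Module (R ⧸ Q) M := htors.module
  have : IsScalarTower R (R ⧸ Q) M := htors.isScalarTower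
  have : Module.Finite (R ⧸ Q) M := Module.Finite.of_restrictScalars_finite R _ _
  have : IsArtinian R M := isArtinian_of_surjective_algebraMap (R := R ⧸ Q)
    Ideal.Quotient.mk_surjective
  exact Module.length_ne_top

theorem Submodule.length_quotient_le_of_le {A B : Submodule R M} (h : A ≤ B) :
    Module.length R (M ⧸ B) ≤ Module.length R (M ⧸ A) :=
  Module.length_le_of_surjective (Submodule.factor h) (Submodule.factor_surjective h)

theorem Submodule.length_quotient_sup_pow_smul_le (x : R) (U : Submodule R M) (n : ℕ) :
    Module.length R (M ⧸ (U ⊔ (⊤ : Submodule R M).map (LinearMap.lsmul R M (x ^ n)))) ≤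
      n * Module.length R (M ⧸ (U ⊔ (⊤ : Submodule R M).map (LinearMap.lsmul R M x))) := by
  let V : ℕ → Submodule R M := fun n => U ⊔ (⊤ : Submodule R M).map (LinearMap.lsmul R M (x ^ n))
  have hxV : ∀ n m, x ^ n • m ∈ V n := fun n m => Submodule.mem_sup_right ⟨m, trivial, rfl⟩
  have hV1 : V 1 = U ⊔ (⊤ : Submodule R M).map (LinearMap.lsmul R M x) := by
    simp only [V, pow_one]
  induction n with
  | zero =>
    rw [Module.length_eq_zero_iff.2]
    · exact zero_le
    · refine Submodule.Quotient.subsingleton_iff.2 (eq_top_iff.2 fun m _ => ?_)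
      have := hxV 0 m
      rwa [pow_zero, one_smul] at this
  | succ n ih =>
    have hle : V (n + 1) ≤ V n := sup_le le_sup_left (by
      rintro _ ⟨m, -, rfl⟩
      rw [LinearMap.lsmul_apply, pow_succ, mul_smul]
      exact hxV n _)
    change Module.length R (M ⧸ V (n + 1)) ≤ _
    rw [Submodule.length_quotient_eq_relLength, Submodule.relLength_add hle le_top,
      ← Submodule.length_quotient_eq_relLength, Nat.cast_succ, add_mul, one_mul, add_comm]
    refine add_le_add ih ?_
    rw [← hV1]
    let φ : M →ₗ[R] (V n ⧸ (V (n + 1)).submoduleOf (V n)) := (Submodule.mkQ _).comp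
      (LinearMap.codRestrict (V n) (LinearMap.lsmul R M (x ^ n)) (hxV n))
    have hφ : V 1 ≤ LinearMap.ker φ := by
      refine sup_le (fun u hu => ?_) ?_
      · refine (Submodule.Quotient.mk_eq_zero _).2 ?_
        exact Submodule.mem_sup_left (Submodule.smul_mem U (x ^ n) hu)
      · rintro _ ⟨m, -, rfl⟩
        refine (Submodule.Quotient.mk_eq_zero _).2 ?_
        change x ^ n • x ^ 1 • m ∈ V (n + 1)
        rw [← mul_smul, ← pow_add]
        exact hxV (n + 1) m
    refine Module.length_le_of_surjective ((V 1).liftQ φ hφ) fun y => ?_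
    obtain ⟨⟨y, hy⟩, rfl⟩ := Submodule.Quotient.mk_surjective _ y
    obtain ⟨u, hu, _, ⟨m, -, rfl⟩, rfl⟩ := Submodule.mem_sup.1 hy
    refine ⟨Submodule.Quotient.mk m, (Submodule.Quotient.eq _).2 ?_⟩
    change x ^ n • m - (u + x ^ n • m) ∈ V (n + 1)
    rw [sub_add_cancel_right]
    exact neg_mem (Submodule.mem_sup_left hu)

theorem Submodule.length_quotient_sup_finsetSup_le (s : Finset R) (n : ℕ) :
    ∀ U : Submodule R M, Module.length R
      (M ⧸ (U ⊔ s.sup fun x => (⊤ : Submodule R M).map (LinearMap.lsmul R M (x ^ n)))) ≤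
      (n : ℕ∞) ^ s.card * Module.length R
        (M ⧸ (U ⊔ s.sup fun x => (⊤ : Submodule R M).map (LinearMap.lsmul R M x))) := by
  classical
  induction s using Finset.induction_on with
  | empty => intro U; rw [Finset.sup_empty, Finset.sup_empty, Finset.card_empty, pow_zero, one_mul]
  | insert x s hx ih =>
    intro U
    rw [Finset.sup_insert, Finset.sup_insert, Finset.card_insert_of_notMem hx, ← sup_assoc]
    refine (ih _).trans ?_
    rw [pow_succ, mul_assoc]
    refine mul_le_mul_right ?_ _
    rw [sup_right_comm]
    refine (Submodule.length_quotient_sup_pow_smul_le x _ n).trans ?_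
    rw [sup_assoc, sup_comm (s.sup _)]

theorem Ideal.length_quotient_pow_smul_le (J : Ideal R) (s : Finset R) (hs : ∀ x ∈ s, x ∈ J)
    (n : ℕ) : Module.length R (M ⧸ (J ^ n • (⊤ : Submodule R M))) ≤
      (n : ℕ∞) ^ s.card * Module.length R
        (M ⧸ (s.sup fun x => (⊤ : Submodule R M).map (LinearMap.lsmul R M x))) := by
  have h := Submodule.length_quotient_sup_finsetSup_le s n (⊥ : Submodule R M)
  rw [bot_sup_eq, bot_sup_eq] at h
  refine (Submodule.length_quotient_le_of_le (Finset.sup_le fun x hx => ?_)).trans h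
  rintro _ ⟨m, -, rfl⟩
  exact Submodule.smul_mem_smul (Ideal.pow_mem_pow (hs x hx) n) trivial

end FiniteLength

section DimensionBound

variable {R : Type*} [CommRing R]

theorem Ideal.exists_isPrime_ringKrullDim_quotient_eq {d : ℕ} (hd : ringKrullDim R = d)
    {I : Ideal R} (hI : ringKrullDim (R ⧸ I) = d) :
    ∃ p : Ideal R, p.IsPrime ∧ I ≤ p ∧ ringKrullDim (R ⧸ p) = d := by
  rw [ringKrullDim_quotient] at hI
  obtain ⟨l, hl⟩ := Order.le_krullDim_iff.1 hI.ge
  refine ⟨l.head.1.asIdeal, l.head.1.2, l.head.2, le_antisymm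
    (hd ▸ ringKrullDim_quotient_le _) ?_⟩
  rw [ringKrullDim_quotient]
  refine Order.le_krullDim_iff.2 ⟨LTSeries.mk l.length
    (fun i => ⟨(l i).1, l.head_le i⟩) (fun i j hij => l.strictMono hij), hl⟩

theorem IsLocalRing.exists_finset_subset_isMaximal [IsLocalRing R] [IsNoetherianRing R]
    {I : Ideal R} {e : ℕ} (he : ringKrullDim (R ⧸ I) = e) {J : Ideal R}
    (hJ : J.radical = maximalIdeal R) :
    ∃ s : Finset R, s.card ≤ e ∧ (∀ x ∈ s, x ∈ J) ∧
      ∀ p : Ideal R, p.IsPrime → I ≤ p → (∀ x ∈ s, x ∈ p) → p.IsMaximal := by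
  classical
  have hnt : Nontrivial (R ⧸ I) := by
    rw [← not_subsingleton_iff_nontrivial]
    intro h
    rw [ringKrullDim_eq_bot_of_subsingleton] at he
    exact absurd he (by simp)
  have hloc : IsLocalRing (R ⧸ I) :=
    IsLocalRing.of_surjective' (Ideal.Quotient.mk I) Ideal.Quotient.mk_surjective
  obtain ⟨t, ht, htc⟩ :=
    (maximalIdeal (R ⧸ I)).exists_finset_card_eq_height_of_isNoetherianRing
  have hte : t.card = e := by
    rw [← IsLocalRing.maximalIdeal_height_eq_ringKrullDim, ← htc] at he
    exact_mod_cast he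
  have hlift : ∀ y : R ⧸ I, ∃ x : R, ∃ k : ℕ, y ∈ t → Ideal.Quotient.mk I x = y ∧ x ^ k ∈ J := by
    intro y
    obtain ⟨x, rfl⟩ := Ideal.Quotient.mk_surjective y
    by_cases hx : Ideal.Quotient.mk I x ∈ t
    · have h₁ : Ideal.Quotient.mk I x ∈ maximalIdeal (R ⧸ I) := ht.1.2 (Ideal.subset_span hx)
      have h₂ : x ∈ maximalIdeal R := fun hu => h₁ (hu.map (Ideal.Quotient.mk I))
      rw [← hJ] at h₂
      obtain ⟨k, hk⟩ := h₂
      exact ⟨x, k, fun _ => ⟨rfl, hk⟩⟩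
    · exact ⟨x, 0, fun h => absurd h hx⟩
  choose x k hxk using hlift
  refine ⟨t.image fun y => x y ^ k y, Finset.card_image_le.trans hte.le, ?_, ?_⟩
  · intro z hz
    obtain ⟨y, hy, rfl⟩ := Finset.mem_image.1 hz
    exact (hxk y hy).2
  · intro p hp hIp hsp
    have hker : RingHom.ker (Ideal.Quotient.mk I) ≤ p := by rwa [Ideal.mk_ker]
    have hp' : (p.map (Ideal.Quotient.mk I)).IsPrime :=
      Ideal.map_isPrime_of_surjective Ideal.Quotient.mk_surjective hker
    have hle : Ideal.span (t : Set (R ⧸ I)) ≤ p.map (Ideal.Quotient.mk I) := by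
      refine Ideal.span_le.2 fun y hy => ?_
      rw [← (hxk y hy).1]
      exact Ideal.mem_map_of_mem _
        (hp.mem_of_pow_mem _ (hsp _ (Finset.mem_image_of_mem _ hy)))
    have hmax : maximalIdeal (R ⧸ I) ≤ p.map (Ideal.Quotient.mk I) :=
      ht.2 ⟨hp', hle⟩ (IsLocalRing.le_maximalIdeal hp'.ne_top)
    have hpm : p.map (Ideal.Quotient.mk I) = maximalIdeal (R ⧸ I) :=
      le_antisymm (IsLocalRing.le_maximalIdeal hp'.ne_top) hmax
    have := Ideal.comap_isMaximal_of_surjective (Ideal.Quotient.mk I)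
      Ideal.Quotient.mk_surjective (K := maximalIdeal (R ⧸ I))
    rwa [← hpm, Ideal.comap_map_of_surjective' _ Ideal.Quotient.mk_surjective,
      sup_eq_left.2 hker] at this

variable [IsLocalRing R] [IsNoetherianRing R] (L : Type*) [AddCommGroup L] [Module R L]
  [Module.Finite R L]

theorem IsLocalRing.length_quotient_pow_smul_ne_top {J : Ideal R}
    (hJ : J.radical = maximalIdeal R) (n : ℕ) :
    Module.length R (L ⧸ (J ^ n • (⊤ : Submodule R L))) ≠ ⊤ := by
  refine Module.length_ne_top_of_le_annihilator (J ^ n) (fun p hp h => ?_) (fun r hr m => ?_)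
  · have h' := Ideal.radical_mono (hp.le_of_pow_le h)
    rw [hJ, hp.radical] at h'
    rw [← (maximalIdeal.isMaximal R).eq_of_le hp.ne_top h']
    infer_instance
  · obtain ⟨m, rfl⟩ := Submodule.Quotient.mk_surjective _ m
    rw [← Submodule.Quotient.mk_smul, Submodule.Quotient.mk_eq_zero]
    exact Submodule.smul_mem_smul hr trivial

/-- If the support of a finitely generated module contains no prime of maximal dimension, then
its Hilbert–Samuel function has smaller growth than the dimension of the ring allows. -/
theorem IsLocalRing.exists_mul_length_quotient_pow_smul_le {d : ℕ} (hd : ringKrullDim R = d)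
    {J : Ideal R} (hJ : J.radical = maximalIdeal R)
    (hL : ∀ p : Ideal R, p.IsPrime → ringKrullDim (R ⧸ p) = d →
      ¬ Module.annihilator R L ≤ p) :
    ∃ c : ℕ, ∀ n : ℕ, 0 < n →
      (n : ℕ∞) * Module.length R (L ⧸ (J ^ n • (⊤ : Submodule R L))) ≤ ((c * n ^ d : ℕ) : ℕ∞) := by
  rcases subsingleton_or_nontrivial L with hs | hnt
  · refine ⟨0, fun n _ => ?_⟩
    rw [Module.length_eq_zero, mul_zero]
    exact zero_le
  set I := Module.annihilator R L with hI
  have hnt' : Nontrivial (R ⧸ I) := by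
    rw [Ideal.Quotient.nontrivial_iff, hI, Ne, Module.annihilator_eq_top_iff,
      not_subsingleton_iff_nontrivial]
    exact hnt
  have hle : ringKrullDim (R ⧸ I) ≤ d := hd ▸ ringKrullDim_quotient_le I
  obtain ⟨e, he⟩ : ∃ e : ℕ, ringKrullDim (R ⧸ I) = e := by
    have h0 := ringKrullDim_nonneg_of_nontrivial (R := R ⧸ I)
    generalize ringKrullDim (R ⧸ I) = x at hle h0
    induction x with
    | bot => simp at h0
    | coe x =>
      induction x with
      | top => exact absurd (WithBot.coe_le_coe.1 hle) (by simp)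
      | coe e => exact ⟨e, rfl⟩
  have hed : e < d := by
    refine lt_of_le_of_ne (by rw [he] at hle; exact_mod_cast hle) ?_
    rintro rfl
    obtain ⟨p, hp, hIp, hpd⟩ := Ideal.exists_isPrime_ringKrullDim_quotient_eq hd he
    exact hL p hp hpd hIp
  obtain ⟨s, hse, hsJ, hs⟩ := IsLocalRing.exists_finset_subset_isMaximal he hJ
  let W : Submodule R L := s.sup fun x => (⊤ : Submodule R L).map (LinearMap.lsmul R L x)
  have hW : Module.length R (L ⧸ W) ≠ ⊤ := by
    refine Module.length_ne_top_of_le_annihilator (I ⊔ Ideal.span s) (fun p hp h => ?_) ?_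
    · exact hs p hp (le_sup_left.trans h)
        (fun x hx => h (Submodule.mem_sup_right (Ideal.subset_span hx)))
    · have : I ⊔ Ideal.span s ≤ Module.annihilator R (L ⧸ W) := by
        refine sup_le (W.mkQ.annihilator_le_of_surjective W.mkQ_surjective)
          (Ideal.span_le.2 fun x hx => Module.mem_annihilator.2 fun m => ?_)
        obtain ⟨m, rfl⟩ := Submodule.Quotient.mk_surjective _ m
        rw [← Submodule.Quotient.mk_smul, Submodule.Quotient.mk_eq_zero]
        exact (Finset.le_sup (f := fun x => (⊤ : Submodule R L).map (LinearMap.lsmul R L x)) hx)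
          ⟨m, trivial, rfl⟩
      exact fun r hr => Module.mem_annihilator.1 (this hr)
  obtain ⟨c, hc⟩ := ENat.ne_top_iff_exists.1 hW
  refine ⟨c, fun n hn => ?_⟩
  calc (n : ℕ∞) * Module.length R (L ⧸ (J ^ n • (⊤ : Submodule R L)))
      ≤ n * ((n : ℕ∞) ^ s.card * c) := by
        rw [hc]
        exact mul_le_mul_right (J.length_quotient_pow_smul_le s hsJ n) _
    _ = ((c * n ^ (s.card + 1) : ℕ) : ℕ∞) := by push_cast; ring
    _ ≤ _ := by
        exact_mod_cast Nat.mul_le_mul_left c (Nat.pow_le_pow_right hn (by omega))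

end DimensionBound

section Gluing

variable {R : Type*} [CommRing R]

theorem Module.not_annihilator_le_of_forall_exists_smul_mem {L : Type*} [AddCommGroup L]
    [Module R L] [Module.Finite R L] (p : Ideal R) [p.IsPrime]
    (h : ∀ z : L, ∃ s ∉ p, s • z ∈ p • (⊤ : Submodule R L)) : ¬ Module.annihilator R L ≤ p := by
  have h₁ : ¬ Module.annihilator R (L ⧸ (p • (⊤ : Submodule R L))) ≤ p := by
    have h₂ : (⟨p, inferInstance⟩ : PrimeSpectrum R) ∉
        Module.support R (L ⧸ (p • (⊤ : Submodule R L))) := by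
      rw [Module.notMem_support_iff']
      intro z
      obtain ⟨z, rfl⟩ := Submodule.Quotient.mk_surjective _ z
      obtain ⟨s, hs, hsz⟩ := h z
      exact ⟨s, hs, (Submodule.Quotient.mk_eq_zero _).2 hsz⟩
    rwa [Module.mem_support_iff_of_finite] at h₂
  obtain ⟨s, hs, hsp⟩ := SetLike.not_le_iff_exists.1 h₁
  have hrange : LinearMap.range (algebraMap R (Module.End R L) s) ≤ p • (⊤ : Submodule R L) := by
    rintro _ ⟨z, rfl⟩
    have := Module.mem_annihilator.1 hs (Submodule.Quotient.mk z)
    exact (Submodule.Quotient.mk_eq_zero _).1 this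
  obtain ⟨q, hq, -, hcoeff, heval⟩ :=
    LinearMap.exists_monic_and_natDegree_eq_and_coeff_mem_pow_and_aeval_eq_zero R _ p hrange
  rw [Polynomial.aeval_algebraMap_apply_eq_algebraMap_eval] at heval
  have hann : q.eval s ∈ Module.annihilator R L :=
    Module.mem_annihilator.2 fun z => LinearMap.congr_fun heval z
  refine fun hle => hsp (Ideal.IsPrime.mem_of_pow_mem inferInstance q.natDegree ?_)
  have hsum := hle hann
  rw [Polynomial.eval_eq_sum_range, Finset.sum_range_succ, hq.coeff_natDegree, one_mul] at hsum
  refine (Ideal.add_mem_iff_right p (Ideal.sum_mem p fun k hk => ?_)).1 hsum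
  refine Ideal.mul_mem_right _ p (Ideal.pow_le_self ?_ (hcoeff k))
  have := Finset.mem_range.1 hk
  omega

theorem exists_linearMap_not_annihilator_le {M N : Type*} [AddCommGroup M] [Module R M]
    [AddCommGroup N] [Module R N] [Module.Finite R N] (S : Finset (Ideal R))
    (hS : ∀ p ∈ S, p.IsPrime) (hinc : ∀ p ∈ S, ∀ q ∈ S, p ≤ q → p = q)
    (hf : ∀ p ∈ S, ∃ f : M →ₗ[R] N, ∀ y, ∃ s ∉ p, s • y ∈ LinearMap.range f) :
    ∃ f : M →ₗ[R] N, ∀ p ∈ S, ¬ Module.annihilator R (N ⧸ LinearMap.range f) ≤ p := by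
  classical
  have ha : ∀ p ∈ S, ∃ a ∉ p, ∀ q ∈ S, q ≠ p → a ∈ q := by
    intro p hp
    have := hS p hp
    have h : ¬ (S.erase p).inf id ≤ p := by
      rw [Ideal.IsPrime.inf_le' this]
      rintro ⟨q, hq, hqp⟩
      exact (Finset.mem_erase.1 hq).1 (hinc q (Finset.mem_erase.1 hq).2 p hp hqp)
    obtain ⟨a, ha, hap⟩ := SetLike.not_le_iff_exists.1 h
    exact ⟨a, hap, fun q hq hqp => Finset.inf_le (f := id) (Finset.mem_erase.2 ⟨hqp, hq⟩) ha⟩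
  choose! a hap haq using ha
  choose! f hf using hf
  refine ⟨∑ p ∈ S, a p • f p, fun p hp => ?_⟩
  have := hS p hp
  refine Module.not_annihilator_le_of_forall_exists_smul_mem p fun z => ?_
  obtain ⟨y, rfl⟩ := Submodule.Quotient.mk_surjective _ z
  obtain ⟨s, hs, m, hm⟩ := hf p hp y
  refine ⟨a p * s, fun h => (this.mem_or_mem h).elim (hap p hp) hs, ?_⟩
  have hsum : (a p * s) • y + ∑ q ∈ S.erase p, a q • f q m = (∑ p ∈ S, a p • f p) m := by
    rw [LinearMap.sum_apply, ← Finset.add_sum_erase S _ hp, mul_smul, ← hm]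
    rfl
  have hzero : Submodule.Quotient.mk (p := LinearMap.range (∑ p ∈ S, a p • f p))
      ((a p * s) • y + ∑ q ∈ S.erase p, a q • f q m) = 0 := by
    rw [hsum]
    exact (Submodule.Quotient.mk_eq_zero _).2 ⟨m, rfl⟩
  rw [Submodule.Quotient.mk_add, Submodule.Quotient.mk_smul] at hzero
  rw [eq_neg_of_add_eq_zero_left hzero]
  refine neg_mem ?_
  rw [← Submodule.mkQ_apply, map_sum]
  refine Submodule.sum_mem _ fun q hq => ?_
  rw [map_smul]
  exact Submodule.smul_mem_smul (haq q (Finset.mem_erase.1 hq).2 p hp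
    (Finset.mem_erase.1 hq).1.symm) trivial

end Gluing

section GenericallyGorenstein

theorem Ideal.mem_minimalPrimes_of_ringKrullDim_quotient_eq {R : Type*} [CommRing R] {d : ℕ}
    (hd : ringKrullDim R = d) (p : Ideal R) [hp : p.IsPrime] (hpd : ringKrullDim (R ⧸ p) = d) :
    p ∈ minimalPrimes R := by
  refine ⟨⟨hp, bot_le⟩, fun q hq hqp => ?_⟩
  by_contra hpq
  obtain ⟨r, hrp, hrq⟩ := SetLike.not_le_iff_exists.1 hpq
  have := hq.1
  have h : ringKrullDim (R ⧸ p) + 1 ≤ ringKrullDim (R ⧸ q) :=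
    ringKrullDim_succ_le_of_surjective (Ideal.Quotient.factor hqp)
      (Ideal.Quotient.factor_surjective hqp) (r := Ideal.Quotient.mk q r)
      (mem_nonZeroDivisors_of_ne_zero fun h => hrq (Ideal.Quotient.eq_zero_iff_mem.1 h))
      (Ideal.Quotient.eq_zero_iff_mem.2 hrp)
  have h' := h.trans (ringKrullDim_quotient_le q)
  rw [hd, hpd] at h'
  exact absurd h' (by norm_cast; omega)

theorem isArtinianRing_localization_atPrime_of_mem_minimalPrimes {R : Type*} [CommRing R]
    [IsNoetherianRing R] (p : Ideal R) [p.IsPrime] (hp : p ∈ minimalPrimes R) :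
    IsArtinianRing (Localization.AtPrime p) := by
  have : IsNoetherianRing (Localization.AtPrime p) :=
    IsLocalization.isNoetherianRing p.primeCompl _ inferInstance
  rw [isArtinianRing_iff_krullDimLE_zero]
  refine Ring.krullDimLE_iff.2 ?_
  rw [IsLocalization.AtPrime.ringKrullDim_eq_height p, Ideal.height_eq_zero_iff.2 hp]
  exact le_rfl

theorem IsSemidualizing.exists_linearMap_atPrime {R : Type} [CommRing R] [IsNoetherianRing R]
    {C : Type} [AddCommGroup C] [Module R C] (hC : IsSemidualizing R C) (p : Ideal R) [p.IsPrime]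
    (hp : p ∈ minimalPrimes R) (hGor : IsGorensteinLocalRing (Localization.AtPrime p)) :
    (∃ f : R →ₗ[R] C, ∀ y, ∃ s ∉ p, s • y ∈ LinearMap.range f) ∧
      ∃ g : C →ₗ[R] R, ∀ y, ∃ s ∉ p, s • y ∈ LinearMap.range g := by
  have := hC.1
  have := Module.finitePresentation_of_finite R C
  have hart := isArtinianRing_localization_atPrime_of_mem_minimalPrimes p hp
  obtain ⟨e⟩ := nonempty_linearEquiv_of_bijective_algebraMap_end
    (A := Localization.AtPrime p) (D := LocalizedModule p.primeCompl C)
    (fun x y hx0 hx hy => exists_mul_eq_of_hasFiniteInjectiveDimension _ hGor.2.2 hx0 hx hy)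
    (bijective_algebraMap_end_localizedModule hC.2.1 p)
  let e' : LocalizedModule p.primeCompl R ≃ₗ[R] LocalizedModule p.primeCompl C :=
    (IsLocalizedModule.linearEquiv p.primeCompl (LocalizedModule.mkLinearMap p.primeCompl R)
      (Algebra.linearMap R (Localization.AtPrime p))).trans (e.restrictScalars R)
  exact ⟨exists_linearMap_of_surjective_localizedModule p.primeCompl e'.toLinearMap e'.surjective,
    exists_linearMap_of_surjective_localizedModule p.primeCompl e'.symm.toLinearMap
      e'.symm.surjective⟩

end GenericallyGorenstein

section Comparison

theorem Polynomial.degree_lt_of_eventually_mul_abs_eval_le {P : Polynomial ℚ} {c d : ℕ}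
    (h : ∀ᶠ n : ℕ in Filter.atTop, (n : ℚ) * |P.eval (n : ℚ)| ≤ c * (n : ℚ) ^ d) :
    P.degree < d := by
  by_contra hdeg
  rw [not_lt, ← Polynomial.degree_X_pow (R := ℚ) d] at hdeg
  obtain ⟨K, hK⟩ := ((Polynomial.isBigO_atTop_of_degree_le _ _ hdeg).comp_tendsto
    (tendsto_natCast_atTop_atTop (R := ℚ))).bound
  have hbound : ∀ᶠ n : ℕ in Filter.atTop, (n : ℝ) ≤ K * c := by
    filter_upwards [h, hK, Filter.eventually_gt_atTop 0] with n h₁ h₂ hn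
    simp only [Function.comp_apply, Polynomial.eval_pow, Polynomial.eval_X] at h₂
    have hnd : (0 : ℝ) < (n : ℝ) ^ d := by positivity
    have hnorm : ∀ x : ℚ, ‖x‖ = |(x : ℝ)| := fun _ => rfl
    rw [hnorm, hnorm] at h₂
    push_cast at h₂
    rw [abs_of_pos hnd] at h₂
    have h₁' : (n : ℝ) * |((P.eval (n : ℚ) : ℚ) : ℝ)| ≤ c * (n : ℝ) ^ d := by exact_mod_cast h₁
    have hK0 : 0 < K := by
      by_contra hK0
      have := mul_nonpos_of_nonpos_of_nonneg (not_lt.1 hK0)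
        (abs_nonneg ((P.eval (n : ℚ) : ℚ) : ℝ))
      linarith
    refine le_of_mul_le_mul_right ?_ hnd
    calc (n : ℝ) * (n : ℝ) ^ d ≤ n * (K * |((P.eval (n : ℚ) : ℚ) : ℝ)|) := by gcongr
      _ = K * (n * |((P.eval (n : ℚ) : ℚ) : ℝ)|) := by ring
      _ ≤ K * (c * (n : ℝ) ^ d) := by gcongr
      _ = K * c * (n : ℝ) ^ d := by ring
  obtain ⟨n, h₁, h₂⟩ := (hbound.and
    ((tendsto_natCast_atTop_atTop (R := ℝ)).eventually_gt_atTop (K * c))).exists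
  linarith

theorem LinearMap.length_quotient_smul_le_add {R M N : Type*} [CommRing R] [AddCommGroup M]
    [Module R M] [AddCommGroup N] [Module R N] (f : M →ₗ[R] N) (I : Ideal R) :
    Module.length R (N ⧸ (I • (⊤ : Submodule R N))) ≤
      Module.length R (M ⧸ (I • (⊤ : Submodule R M))) +
        Module.length R ((N ⧸ range f) ⧸ (I • (⊤ : Submodule R (N ⧸ range f)))) := by
  let B : Submodule R N := I • ⊤
  let K : Submodule R N := range f ⊔ B
  rw [Submodule.length_quotient_eq_relLength, Submodule.relLength_add (K := K) le_sup_right le_top]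
  refine add_le_add ?_ (le_of_eq ?_)
  · let φ : M →ₗ[R] (K ⧸ B.submoduleOf K) := (Submodule.mkQ _).comp
      (f.codRestrict K (fun m => Submodule.mem_sup_left ⟨m, rfl⟩))
    have hφ : I • (⊤ : Submodule R M) ≤ LinearMap.ker φ := by
      refine Submodule.smul_le.2 fun r hr m _ => (Submodule.Quotient.mk_eq_zero _).2 ?_
      change f (r • m) ∈ B
      rw [map_smul]
      exact Submodule.smul_mem_smul hr trivial
    refine Module.length_le_of_surjective (Submodule.liftQ _ φ hφ) fun y => ?_
    obtain ⟨⟨y, hy⟩, rfl⟩ := Submodule.Quotient.mk_surjective _ y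
    obtain ⟨_, ⟨m, rfl⟩, b, hb, rfl⟩ := Submodule.mem_sup.1 hy
    refine ⟨Submodule.Quotient.mk m, (Submodule.Quotient.eq _).2 ?_⟩
    change f m - (f m + b) ∈ B
    rw [sub_add_cancel_left]
    exact neg_mem hb
  · refine Submodule.relLength_eq_of_surjective
      ((Submodule.mkQ _).comp ((range f).mkQ.comp (⊤ : Submodule R N).subtype))
      ((Submodule.mkQ_surjective _).comp ((Submodule.mkQ_surjective _).comp
        fun y => ⟨⟨y, trivial⟩, rfl⟩)) fun a => ?_
    have hmap : I • (⊤ : Submodule R (N ⧸ range f)) = B.map (range f).mkQ := by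
      rw [Submodule.map_smul'', Submodule.map_top, Submodule.range_mkQ]
    refine (Submodule.Quotient.mk_eq_zero _).trans ?_
    change (range f).mkQ (a : N) ∈ I • (⊤ : Submodule R (N ⧸ range f)) ↔ _
    rw [hmap, ← Submodule.mem_comap, Submodule.comap_map_mkQ]

/-- If `N` is generated by the image of `M` at all primes of maximal dimension, then the
Hilbert–Samuel function of `N` is bounded by that of `M` up to terms of lower order. -/
theorem IsLocalRing.exists_mul_sub_length_quotient_pow_smul_le {R M N : Type*} [CommRing R]
    [IsLocalRing R] [IsNoetherianRing R] [AddCommGroup M] [Module R M] [Module.Finite R M]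
    [AddCommGroup N] [Module R N] [Module.Finite R N] {d : ℕ} (hd : ringKrullDim R = d)
    {J : Ideal R} (hJ : J.radical = maximalIdeal R) (f : M →ₗ[R] N)
    (hf : ∀ p : Ideal R, p.IsPrime → ringKrullDim (R ⧸ p) = d →
      ¬ Module.annihilator R (N ⧸ LinearMap.range f) ≤ p) :
    ∃ c : ℕ, ∀ n : ℕ, 0 < n →
      (n : ℚ) * (((Module.length R (N ⧸ (J ^ n • (⊤ : Submodule R N)))).toNat : ℚ) -
        ((Module.length R (M ⧸ (J ^ n • (⊤ : Submodule R M)))).toNat : ℚ)) ≤ c * (n : ℚ) ^ d := by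
  obtain ⟨c, hc⟩ := IsLocalRing.exists_mul_length_quotient_pow_smul_le (N ⧸ LinearMap.range f)
    hd hJ hf
  refine ⟨c, fun n hn => ?_⟩
  have h₁ := hc n hn
  have h₂ := f.length_quotient_smul_le_add (J ^ n)
  obtain ⟨a, ha⟩ := ENat.ne_top_iff_exists.1 (IsLocalRing.length_quotient_pow_smul_ne_top N hJ n)
  obtain ⟨b, hb⟩ := ENat.ne_top_iff_exists.1 (IsLocalRing.length_quotient_pow_smul_ne_top M hJ n)
  obtain ⟨l, hl⟩ := ENat.ne_top_iff_exists.1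
    (IsLocalRing.length_quotient_pow_smul_ne_top (N ⧸ LinearMap.range f) hJ n)
  rw [← ha, ← hb, ← hl] at h₂
  rw [← hl] at h₁
  rw [← ha, ← hb, ENat.toNat_natCast, ENat.toNat_natCast]
  have h₁' : (n : ℚ) * l ≤ c * (n : ℚ) ^ d := by exact_mod_cast h₁
  have h₂' : (a : ℚ) ≤ b + l := by exact_mod_cast h₂
  refine le_trans (mul_le_mul_of_nonneg_left ?_ (Nat.cast_nonneg n)) h₁'
  linarith

theorem moduleLength_eq_toNat {R M : Type} [CommRing R] [AddCommGroup M] [Module R M]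
    (h : Module.length R M ≠ ⊤) :
    moduleLength R M = ((Module.length R M).toNat : WithBot ℕ∞) := by
  rw [moduleLength, ← Module.coe_length]
  conv_lhs => rw [← ENat.natCast_toNat h]
  rfl

end Comparison

/-- if `(R,m)` is Noetherian local of dimension `d` with `R_p` Gorenstein for
every prime `p` with `dim(R/p) = d`, then for every semidualizing `R`-module `C` and every
`m`-primary ideal `J` we have `e(J,C) = e(J,R)`, i.e. `n ↦ ℓ(C/J^nC) − ℓ(R/J^n)` agrees for
large `n` with a polynomial of degree `< d`. -/
theorem statement0
    (R : Type) [CommRing R] [IsLocalRing R] [IsNoetherianRing R]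
    (d : ℕ) (hd : ringKrullDim R = d)
    (hGor : ∀ (p : Ideal R) [p.IsPrime], ringKrullDim (R ⧸ p) = d →
      IsGorensteinLocalRing (Localization.AtPrime p))
    (C : Type) [AddCommGroup C] [Module R C] (hC : IsSemidualizing R C)
    (J : Ideal R) (hJ : J.radical = IsLocalRing.maximalIdeal R) :
    ∃ p : Polynomial ℚ, p.degree < (d : WithBot ℕ) ∧
      ∀ᶠ n : ℕ in Filter.atTop, ∃ a b : ℕ,
        moduleLength R (C ⧸ (J ^ n • (⊤ : Submodule R C))) = (a : WithBot ℕ∞) ∧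
        moduleLength R (R ⧸ (J ^ n)) = (b : WithBot ℕ∞) ∧
        (a : ℚ) - (b : ℚ) = p.eval (n : ℚ) := by
  classical
  have hfin := hC.1
  let S : Finset (Ideal R) :=
    (minimalPrimes.finite_of_isNoetherianRing R).toFinset.filter
      fun p => ringKrullDim (R ⧸ p) = d
  have hS : ∀ p, p ∈ S ↔ p ∈ minimalPrimes R ∧ ringKrullDim (R ⧸ p) = d := fun p => by
    simp [S]
  have hprime : ∀ p ∈ S, p.IsPrime := fun p hp => ((hS p).1 hp).1.1.1
  have hinc : ∀ p ∈ S, ∀ q ∈ S, p ≤ q → p = q := fun p hp q hq hpq =>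
    le_antisymm hpq (((hS q).1 hq).1.2 ((hS p).1 hp).1.1 hpq)
  have hmem : ∀ p : Ideal R, p.IsPrime → ringKrullDim (R ⧸ p) = d → p ∈ S := fun p hp hpd =>
    (hS p).2 ⟨Ideal.mem_minimalPrimes_of_ringKrullDim_quotient_eq hd p hpd, hpd⟩
  have hloc : ∀ p ∈ S, (∃ f : R →ₗ[R] C, ∀ y, ∃ s ∉ p, s • y ∈ LinearMap.range f) ∧
      ∃ g : C →ₗ[R] R, ∀ y, ∃ s ∉ p, s • y ∈ LinearMap.range g := fun p hp => by
    have := hprime p hp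
    exact hC.exists_linearMap_atPrime p ((hS p).1 hp).1 (hGor p ((hS p).1 hp).2)
  obtain ⟨f, hf⟩ := exists_linearMap_not_annihilator_le S hprime hinc fun p hp => (hloc p hp).1
  obtain ⟨g, hg⟩ := exists_linearMap_not_annihilator_le S hprime hinc fun p hp => (hloc p hp).2
  obtain ⟨c₁, hc₁⟩ := IsLocalRing.exists_mul_sub_length_quotient_pow_smul_le hd hJ f
    fun p hp hpd => hf p (hmem p hp hpd)
  obtain ⟨c₂, hc₂⟩ := IsLocalRing.exists_mul_sub_length_quotient_pow_smul_le hd hJ g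
    fun p hp hpd => hg p (hmem p hp hpd)
  have hlenC := IsLocalRing.length_quotient_pow_smul_ne_top C hJ
  have hlenR := IsLocalRing.length_quotient_pow_smul_ne_top R hJ
  obtain ⟨P₁, hP₁⟩ := exists_polynomial_length_quotient_pow_smul J hlenC
  obtain ⟨P₂, hP₂⟩ := exists_polynomial_length_quotient_pow_smul J hlenR
  refine ⟨P₁ - P₂, Polynomial.degree_lt_of_eventually_mul_abs_eval_le (c := c₁ + c₂) ?_, ?_⟩
  · filter_upwards [hP₁, hP₂, Filter.eventually_gt_atTop 0] with n h₁ h₂ hn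
    have h₃ := hc₁ n hn
    have h₄ := hc₂ n hn
    rw [h₁, h₂] at h₃ h₄
    have hnd : (0 : ℚ) ≤ (n : ℚ) ^ d := by positivity
    have h₅ : (0 : ℚ) ≤ c₁ * (n : ℚ) ^ d := by positivity
    have h₆ : (0 : ℚ) ≤ c₂ * (n : ℚ) ^ d := by positivity
    rw [Polynomial.eval_sub]
    push_cast
    rcases abs_cases (P₁.eval (n : ℚ) - P₂.eval (n : ℚ)) with ⟨h, -⟩ | ⟨h, -⟩ <;> rw [h] <;>
      linarith
  · filter_upwards [hP₁, hP₂] with n h₁ h₂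
    refine ⟨_, (Module.length R (R ⧸ (J ^ n • (⊤ : Submodule R R)))).toNat,
      moduleLength_eq_toNat (hlenC n), ?_, ?_⟩
    · have h := hlenR n
      have htop : J ^ n • (⊤ : Submodule R R) = J ^ n := by rw [smul_eq_mul, Ideal.mul_top]
      rw [htop] at h ⊢
      exact moduleLength_eq_toNat h
    · rw [Polynomial.eval_sub, ← h₁, ← h₂]
end

section
/- Let R be a commutative Noetherian ring such that R_p is a Gorenstein local ring for every associated prime p of R, and let C be a semidualizing R-module. Then C has rank 1, i.e., C_p is a free R_p-module of rank 1 for every associated prime p of R. -/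
open CategoryTheory

/-- Vanishing of `Ext` computed by a projective resolution in the first argument implies vanishing
of `Abelian.Ext`. -/
theorem subsingleton_abelianExt_of_subsingleton_extModule {R : Type} [CommRing R]
    (M N : ModuleCat.{0} R) (n : ℕ) (h : Subsingleton (ExtModule R M N (n + 1))) :
    Subsingleton (Abelian.Ext M N (n + 1)) := by
  let P := projectiveResolution M
  have hz : Limits.IsZero ((P.complex.linearYonedaObj R N).homology (n + 1)) :=
    (ModuleCat.isZero_of_iff_subsingleton.mpr h).of_iso (P.isoExt (n + 1) N).symm
  rw [← HomologicalComplex.exactAt_iff_isZero_homology,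
    HomologicalComplex.exactAt_iff' _ n (n + 1) (n + 2) (by simp) (by simp),
    ShortComplex.moduleCat_exact_iff] at hz
  refine subsingleton_of_forall_eq 0 fun α ↦ ?_
  obtain ⟨f, hf, rfl⟩ := P.extMk_surjective α (n + 2) rfl
  rw [P.extMk_eq_zero_iff f _ rfl hf n rfl]
  exact hz f hf

/-- Over a Noetherian local ring, vanishing of `Ext^(n+2)(-, R)` on finite modules descends to
`Ext^(n+1)(-, R)` if the maximal ideal is the annihilator of an element. -/
theorem subsingleton_ext_succ_of_subsingleton_ext_succ_succ {R : Type} [CommRing R]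
    [IsNoetherianRing R] [IsLocalRing R]
    (s : R) (hs : ∀ x : R, x ∈ IsLocalRing.maximalIdeal R ↔ x * s = 0) (n : ℕ)
    (h : ∀ (N : Type) [AddCommGroup N] [Module R N] [Module.Finite R N],
      Subsingleton (Abelian.Ext (ModuleCat.of R N) (ModuleCat.of R R) (n + 2)))
    (N : Type) [AddCommGroup N] [Module R N] [hN : Module.Finite R N] :
    Subsingleton (Abelian.Ext (ModuleCat.of R N) (ModuleCat.of R R) (n + 1)) := by
  induction hN using IsNoetherianRing.induction_on_isQuotientEquivQuotientPrime R with
  | subsingleton N =>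
    have : Projective (ModuleCat.of R N) :=
      (ModuleCat.isZero_of_iff_subsingleton.mpr inferInstance).projective
    exact Abelian.Ext.subsingleton_of_projective _ _ _
  | exact N₁ N₂ N₃ f g hf hg hfg h₁ h₃ =>
    let S : ShortComplex (ModuleCat R) :=
      ModuleCat.shortComplexOfCompEqZero f g hfg.linearMap_comp_eq_zero
    have hS : S.ShortExact := ModuleCat.shortComplex_shortExact S hfg hf hg
    refine subsingleton_of_forall_eq 0 fun x ↦ ?_
    obtain ⟨y, rfl⟩ := Abelian.Ext.contravariant_sequence_exact₂ hS _ x (h₁.elim _ _)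
    rw [h₃.elim y 0, Abelian.Ext.comp_zero]
  | quotient N p e =>
    by_cases hp : p.1 = IsLocalRing.maximalIdeal R
    · -- embed the residue field into `R`
      let t := LinearMap.toSpanSingleton R R s
      have ht : p.1 = LinearMap.ker t := by ext x; simp [t, hp, hs]
      let f : N →ₗ[R] R := p.1.liftQ t ht.le ∘ₗ e.toLinearMap
      have hf : Function.Injective f := by
        rw [LinearMap.coe_comp]
        exact (LinearMap.ker_eq_bot.mp (Submodule.ker_liftQ_eq_bot _ _ ht.le ht.ge)).comp e.injective
      let S : ShortComplex (ModuleCat R) :=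
        ModuleCat.shortComplexOfCompEqZero _ _ f.exact_map_mkQ_range.linearMap_comp_eq_zero
      have hS : S.ShortExact := ModuleCat.shortComplex_shortExact S
        f.exact_map_mkQ_range hf (Submodule.mkQ_surjective _)
      refine subsingleton_of_forall_eq 0 fun x ↦ ?_
      obtain ⟨y, rfl⟩ := Abelian.Ext.contravariant_sequence_exact₁ hS _ x (add_comm 1 (n + 1))
        ((h (R ⧸ LinearMap.range f)).elim _ _)
      have : Projective S.X₂ := inferInstanceAs (Projective (ModuleCat.of R R))
      rw [y.eq_zero_of_projective, Abelian.Ext.comp_zero]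
    · obtain ⟨y, hym, hyp⟩ : ∃ y ∈ IsLocalRing.maximalIdeal R, y ∉ p.1 :=
        SetLike.not_le_iff_exists.mp fun hle ↦
          hp (le_antisymm (IsLocalRing.le_maximalIdeal p.2.ne_top) hle)
      -- multiplication by `y` is injective on `N`, hence surjective on `Ext`
      let f : N →ₗ[R] N := LinearMap.lsmul R N y
      have hf : Function.Injective f := by
        rw [← LinearMap.ker_eq_bot, LinearMap.ker_eq_bot']
        intro x hx
        obtain ⟨x, rfl⟩ := e.symm.surjective x
        obtain ⟨x, rfl⟩ := Ideal.Quotient.mk_surjective x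
        have hx' : y • Ideal.Quotient.mk p.1 x = 0 := by
          simpa [f, ← map_smul] using hx
        rw [Algebra.smul_def, Ideal.Quotient.algebraMap_eq, ← map_mul,
          Ideal.Quotient.eq_zero_iff_mem] at hx'
        rw [Ideal.Quotient.eq_zero_iff_mem.mpr ((p.2.mem_or_mem hx').resolve_left hyp), map_zero]
      let S : ShortComplex (ModuleCat R) :=
        ModuleCat.shortComplexOfCompEqZero _ _ f.exact_map_mkQ_range.linearMap_comp_eq_zero
      have hS : S.ShortExact := ModuleCat.shortComplex_shortExact S
        f.exact_map_mkQ_range hf (Submodule.mkQ_surjective _)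
      have hSf : S.f = y • 𝟙 S.X₁ := by ext; rfl
      have htop : (⊤ : Submodule R (Abelian.Ext (ModuleCat.of R N) (ModuleCat.of R R) (n + 1))) ≤
          IsLocalRing.maximalIdeal R • ⊤ := by
        intro x _
        obtain ⟨z, hz⟩ := Abelian.Ext.contravariant_sequence_exact₁ hS _ x (add_comm 1 (n + 1))
          ((h (N ⧸ LinearMap.range f)).elim _ _)
        have hz' : y • z = x := by
          rw [← hz, hSf, Abelian.Ext.mk₀_smul, Abelian.Ext.smul_comp]
          exact congrArg (y • ·) (Abelian.Ext.mk₀_id_comp z).symm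
        rw [← hz']
        exact Submodule.smul_mem_smul hym trivial
      have hbot := Submodule.eq_bot_of_le_smul_of_le_jacobson_bot _ _ Module.Finite.fg_top htop
        (IsLocalRing.maximalIdeal_le_jacobson _)
      exact (Submodule.subsingleton_iff R).mp (subsingleton_of_bot_eq_top hbot.symm)

/-- A Noetherian local ring of depth zero with finite injective dimension is self-injective. -/
theorem IsGorensteinLocalRing.baer {R : Type} [CommRing R] [IsLocalRing R]
    (hR : IsGorensteinLocalRing R)
    (s : R) (hs : ∀ x : R, x ∈ IsLocalRing.maximalIdeal R ↔ x * s = 0) : Module.Baer R R := by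
  obtain ⟨_, -, n, hn⟩ := hR
  have key : ∀ (N : Type) [AddCommGroup N] [Module R N] [Module.Finite R N],
      Subsingleton (Abelian.Ext (ModuleCat.of R N) (ModuleCat.of R R) 1) := by
    have hn' : ∀ (N : Type) [AddCommGroup N] [Module R N] [Module.Finite R N],
        Subsingleton (Abelian.Ext (ModuleCat.of R N) (ModuleCat.of R R) (n + 1)) :=
      fun N _ _ _ ↦ subsingleton_abelianExt_of_subsingleton_extModule _ _ _ (hn _ _ (by lia))
    clear hn
    induction n with
    | zero => exact hn'
    | succ n ih => exact ih (subsingleton_ext_succ_of_subsingleton_ext_succ_succ s hs n hn')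
  intro I g
  let S : ShortComplex (ModuleCat R) :=
    ModuleCat.shortComplexOfCompEqZero I.subtype I.mkQ
      (LinearMap.exact_subtype_mkQ I).linearMap_comp_eq_zero
  have hS : S.ShortExact := ModuleCat.shortComplex_shortExact S
    (LinearMap.exact_subtype_mkQ I) I.injective_subtype I.mkQ_surjective
  obtain ⟨y, hy⟩ := Abelian.Ext.contravariant_sequence_exact₁ hS (ModuleCat.of R R)
    (Abelian.Ext.mk₀ (ModuleCat.ofHom g)) (add_zero 1) ((key (R ⧸ I)).elim _ _)
  obtain ⟨y, rfl⟩ := Abelian.Ext.homEquiv₀.symm.surjective y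
  have hy' : S.f ≫ y = ModuleCat.ofHom g := by
    apply Abelian.Ext.homEquiv₀.symm.injective
    simpa using hy
  exact ⟨y.hom, fun x hx ↦ congr(($hy').hom ⟨x, hx⟩)⟩

/-- Over a self-injective local ring whose maximal ideal is the annihilator of an element, a
faithful module all of whose endomorphisms are homotheties is free of rank one. -/
theorem nonempty_linearEquiv_of_baer {R C : Type} [CommRing R] [IsLocalRing R]
    [AddCommGroup C] [Module R C] (hR : Module.Baer R R)
    (s : R) (hs : ∀ x : R, x ∈ IsLocalRing.maximalIdeal R ↔ x * s = 0)
    (hC : Function.Bijective (algebraMap R (Module.End R C))) : Nonempty (C ≃ₗ[R] R) := by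
  have hs0 : s ≠ 0 := by
    rintro rfl
    exact (IsLocalRing.maximalIdeal.isMaximal R).ne_top
      (Ideal.eq_top_iff_one _ |>.mpr ((hs 1).mpr (by simp)))
  obtain ⟨c, hc⟩ : ∃ c : C, s • c ≠ 0 := by
    by_contra! h
    exact hs0 (hC.1 (by ext c; simpa using h c))
  have hker : LinearMap.ker (LinearMap.toSpanSingleton R C (s • c)) ≤
      LinearMap.ker (LinearMap.toSpanSingleton R R s) := by
    intro x hx
    simp only [LinearMap.mem_ker, LinearMap.toSpanSingleton_apply, smul_eq_mul] at hx ⊢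
    rw [← hs]
    by_contra hxm
    have hu : IsUnit x := by simpa using hxm
    exact hc (hu.smul_eq_zero.mp hx)
  -- `s • c` can be mapped to `s`, and this map extends to `C`
  obtain ⟨f, hf⟩ : ∃ f : C →ₗ[R] R, f (s • c) = s := by
    let t := LinearMap.toSpanSingleton R C (s • c)
    let g : LinearMap.range t →ₗ[R] R :=
      (LinearMap.ker t).liftQ (LinearMap.toSpanSingleton R R s) hker ∘ₗ
        t.quotKerEquivRange.symm.toLinearMap
    obtain ⟨f, hf⟩ := hR.extension_property (LinearMap.range t).subtype
      (LinearMap.range t).injective_subtype g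
    refine ⟨f, ?_⟩
    have h1 : s • c = (LinearMap.range t).subtype ⟨t 1, 1, rfl⟩ := by simp [t]
    rw [h1, ← LinearMap.comp_apply, hf]
    have h2 : t.quotKerEquivRange.symm ⟨t 1, 1, rfl⟩ = (LinearMap.ker t).mkQ 1 :=
      t.quotKerEquivRange_symm_apply_image 1 _
    simp only [g, LinearMap.comp_apply, LinearEquiv.coe_coe, h2, Submodule.mkQ_apply,
      Submodule.liftQ_apply]
    simp
  have hu : IsUnit (f c) := by
    by_contra h
    rw [← mem_nonunits_iff, ← IsLocalRing.mem_maximalIdeal, hs] at h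
    rw [map_smul, smul_eq_mul, mul_comm, h] at hf
    exact hs0 hf.symm
  obtain ⟨r, hr⟩ := hC.2 (f.smulRight c)
  have hr' (x : C) : r • x = f x • c := by simpa using congr($hr x)
  have hr1 : r = f c := by
    have h := congr(f $(hr' c))
    simp only [map_smul, smul_eq_mul] at h
    exact hu.mul_right_cancel h
  refine ⟨LinearEquiv.ofBijective f ⟨?_, fun x ↦ ?_⟩⟩
  · rw [← LinearMap.ker_eq_bot, LinearMap.ker_eq_bot']
    intro x hx
    have h := hr' x
    rw [hx, zero_smul, hr1] at h
    exact hu.smul_eq_zero.mp h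
  · obtain ⟨v, hv⟩ := hu.exists_right_inv
    exact ⟨(x * v) • c, by rw [map_smul, smul_eq_mul, mul_assoc, mul_comm v, hv, mul_one]⟩

/-- Bijectivity of the homothety map of a finitely presented module localizes. -/
theorem bijective_algebraMap_end_localizedModule_s2 {R C : Type} [CommRing R]
    [AddCommGroup C] [Module R C] [Module.FinitePresentation R C] (S : Submonoid R)
    (hC : Function.Bijective (algebraMap R (Module.End R C))) :
    Function.Bijective
      (algebraMap (Localization S) (Module.End (Localization S) (LocalizedModule S C))) := by
  let ι := LocalizedModule.mkLinearMap S C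
  constructor
  · rw [injective_iff_map_eq_zero]
    intro x hx
    obtain ⟨a, s, rfl⟩ := IsLocalization.exists_mk'_eq S x
    have h0 : ι.comp (algebraMap R (Module.End R C) a) = ι.comp (0 : C →ₗ[R] C) := by
      ext c
      have h := congr((s : R) • $hx (ι c))
      rw [Module.algebraMap_end_apply, ← smul_assoc, IsLocalization.smul_mk'_self] at h
      simpa using h
    obtain ⟨t, ht⟩ := Module.Finite.exists_smul_of_comp_eq_of_isLocalizedModule S ι _ _ h0
    rw [IsLocalization.mk'_eq_zero_iff]
    refine ⟨t, hC.1 ?_⟩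
    ext c
    have h := congr($ht c)
    simpa [mul_smul, smul_comm a, Submonoid.smul_def] using h
  · intro φ
    obtain ⟨h, s, hφ⟩ := Module.FinitePresentation.exists_lift_of_isLocalizedModule S ι
      (φ.restrictScalars R ∘ₗ ι)
    obtain ⟨a, rfl⟩ := hC.2 h
    refine ⟨IsLocalization.mk' _ a s, ?_⟩
    apply LinearMap.restrictScalars_injective R
    apply IsLocalizedModule.linearMap_ext S ι ι
    ext c
    have h : a • ι c = s • φ (ι c) := by simpa using congr($hφ c)
    have hι := IsLocalizedModule.map_units ι s
    apply ((Module.End.isUnit_iff _).mp hι).1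
    simp only [Module.algebraMap_end_apply]
    rw [LinearMap.comp_apply, LinearMap.comp_apply]
    simp only [LinearMap.restrictScalars_apply, Module.algebraMap_end_apply]
    rw [← smul_assoc, IsLocalization.smul_mk'_self]
    simpa [Submonoid.smul_def] using h

/-- over a Noetherian ring which is Gorenstein at all associated primes,
every semidualizing module has rank 1: it is free of rank 1 at every associated prime. -/
theorem statement2
    (R : Type) [CommRing R] [IsNoetherianRing R]
    (hGor : ∀ (p : Ideal R) [p.IsPrime], p ∈ associatedPrimes R R →
      IsGorensteinLocalRing (Localization.AtPrime p))
    (C : Type) [AddCommGroup C] [Module R C] (hC : IsSemidualizing R C) :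
    ∀ (p : Ideal R) [p.IsPrime], p ∈ associatedPrimes R R →
      Module.Free (Localization.AtPrime p) (LocalizedModule p.primeCompl C) ∧
      Module.finrank (Localization.AtPrime p) (LocalizedModule p.primeCompl C) = 1 := by
  intro p _ hp
  have := hC.1
  obtain ⟨-, hlocal, -⟩ := hGor p hp
  obtain ⟨-, x, hx⟩ := isAssociatedPrime_iff.mp hp
  let A := Localization.AtPrime p
  have hs (y : A) : y ∈ IsLocalRing.maximalIdeal A ↔ y * algebraMap R A x = 0 := by
    obtain ⟨a, t, rfl⟩ := IsLocalization.exists_mk'_eq p.primeCompl y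
    have hmem (b : R) : b ∈ p ↔ b * x = 0 := by
      conv_lhs => rw [hx]
      simp [Submodule.mem_colon_singleton]
    rw [IsLocalization.AtPrime.mk'_mem_maximal_iff A p, mul_comm,
      IsLocalization.mul_mk'_eq_mk'_of_mul, IsLocalization.mk'_eq_zero_iff]
    constructor
    · intro ha
      exact ⟨1, by rw [mul_comm x, (hmem a).mp ha, mul_zero]⟩
    · rintro ⟨u, hu⟩
      have : (u : R) * a ∈ p := by rw [hmem, mul_assoc, mul_comm a, hu]
      exact (Ideal.IsPrime.mem_or_mem ‹_› this).resolve_left u.2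
  have : Module.FinitePresentation R C := Module.finitePresentation_of_finite R C
  obtain ⟨e⟩ := nonempty_linearEquiv_of_baer ((hGor p hp).baer _ hs) _ hs
    (bijective_algebraMap_end_localizedModule_s2 p.primeCompl hC.2.1)
  exact ⟨Module.Free.of_equiv e.symm, by rw [e.finrank_eq, Module.finrank_self]⟩
end
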